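/- arXiv:2508.08932 — 2 statements merged into one kernel-verified Lean document; each statement's English description precedes it below -/
import Mathlib

section
/- Let X be a geodesic δ-hyperbolic metric space, let G be a group that is not virtually cyclic acting on X by isometries with a unital axial WPD loxodromic element f ∈ G, let x₀ ∈ Ax(f), and let S be a finite generating set of G. Then there exists r > 0 such that for every R > 0 and every y ∈ X there exists an r-roughly branching subset B = B₁ ⊔ B₂ ⊔ … ⊔ B_{⌊R/r⌋} ⊆ G such that, for every g ∈ G with gx₀ ∈ 𝓗_R(x₀,y), every d_S-path connecting id to g passes through each of B₁, …, B_{⌊R/r⌋}. -/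
noncomputable section

open Set Metric Pointwise

/-- The Gromov product `(y|z)_x`. -/
def gromovProd {X : Type*} [MetricSpace X] (x y z : X) : ℝ :=
  (dist x y + dist x z - dist y z) / 2

/-- `γ` restricted to `[a, b]` is a unit-speed geodesic. -/
def IsGeodesicParam {X : Type*} [MetricSpace X] (γ : ℝ → X) (a b : ℝ) : Prop :=
  ∀ s ∈ Set.Icc a b, ∀ t ∈ Set.Icc a b, dist (γ s) (γ t) = |s - t|

/-- `γ` is a geodesic from `x` to `y`, parametrized by arclength on `[0, dist x y]`. -/
def IsGeodesicBetween {X : Type*} [MetricSpace X] (γ : ℝ → X) (x y : X) : Prop :=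
  γ 0 = x ∧ γ (dist x y) = y ∧ IsGeodesicParam γ 0 (dist x y)

/-- A geodesic metric space: any two points are joined by a geodesic. -/
def GeodesicSpace (X : Type*) [MetricSpace X] : Prop :=
  ∀ x y : X, ∃ γ : ℝ → X, IsGeodesicBetween γ x y

/-- A geodesic space in which every geodesic triangle is `δ`-thin. -/
def GromovHyperbolic (X : Type*) [MetricSpace X] (δ : ℝ) : Prop :=
  GeodesicSpace X ∧
    ∀ (x y z : X) (γ₁ γ₂ γ₃ : ℝ → X),
      IsGeodesicBetween γ₁ x z → IsGeodesicBetween γ₂ x y → IsGeodesicBetween γ₃ y z →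
        ∀ t ∈ Set.Icc (0 : ℝ) (dist x z),
          ∃ u ∈ γ₂ '' Set.Icc (0 : ℝ) (dist x y) ∪ γ₃ '' Set.Icc (0 : ℝ) (dist y z),
            dist (γ₁ t) u ≤ δ

/-- A subset of `X` which is the image of a geodesic segment. -/
def IsGeodesicSegSet {X : Type*} [MetricSpace X] (A : Set X) : Prop :=
  ∃ (γ : ℝ → X) (a b : ℝ), a ≤ b ∧ IsGeodesicParam γ a b ∧ A = γ '' Set.Icc a b

/-- The set of nearest-point projections of `x` to `A`. -/
def nearestPts {X : Type*} [MetricSpace X] (A : Set X) (x : X) : Set X :=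
  {a ∈ A | dist x a = Metric.infDist x A}

/-- The nearest-point projection of the set `B` to `A`. -/
def projSet {X : Type*} [MetricSpace X] (A B : Set X) : Set X := ⋃ x ∈ B, nearestPts A x

/-- `diam_A(B)`, the diameter of the projection of `B` to `A`. -/
def projDiam {X : Type*} [MetricSpace X] (A B : Set X) : ℝ := Metric.diam (projSet A B)

/-- `d_A(B, C) = diam (π_A (B ∪ C))`. -/
def projDist {X : Type*} [MetricSpace X] (A B C : Set X) : ℝ := Metric.diam (projSet A (B ∪ C))

/-- The halfspace `H_half(x, y)` of points at least as close to `x` as to `y`. -/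
def halfspace {X : Type*} [MetricSpace X] (x y : X) : Set X := {z | dist z x ≤ dist z y}

/-- A group is virtually cyclic if it has a cyclic subgroup of finite index. -/
def VirtuallyCyclic (G : Type*) [Group G] : Prop :=
  ∃ H : Subgroup G, H.FiniteIndex ∧ IsCyclic H

/-- The WPD property for `f` relative to the basepoint `x₀`. -/
def WPD {G : Type*} [Group G] {X : Type*} [MetricSpace X] [MulAction G X]
    (f : G) (x₀ : X) : Prop :=
  ∀ R : ℝ, 0 < R → ∃ L : ℕ, 0 < L ∧
    {g : G | dist x₀ (g • x₀) < R ∧ dist ((f ^ L) • x₀) ((g * f ^ L) • x₀) < R}.Finite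

/-- The word norm with respect to the generating set `S`. -/
def wordNorm {G : Type*} [Group G] (S : Finset G) (g : G) : ℕ :=
  sInf {n : ℕ | ∃ l : List G, l.length = n ∧ (∀ x ∈ l, x ∈ S ∨ x⁻¹ ∈ S) ∧ l.prod = g}

/-- The word metric with respect to the generating set `S`. -/
def wordDist {G : Type*} [Group G] (S : Finset G) (g h : G) : ℕ := wordNorm S (g⁻¹ * h)

/-- `B` is an `r`-roughly branching subset of `G`. -/
def RoughlyBranching {G : Type*} [Group G] (S : Finset G) (r : ℝ) (B : Set G) : Prop :=
  ∃ B' : Set G,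
    (∀ b ∈ B, ∃ b' ∈ B', (wordDist S b b' : ℝ) ≤ r) ∧
    ∀ k : ℕ, 1 ≤ k → ∀ g h : Fin k → G, (∀ i, g i ∈ B') → (∀ i, h i ∈ B') →
      (List.ofFn g).prod = (List.ofFn h).prod → g = h

/-- Gromov's four-point inequality with constant `δ`. -/
def FourPoint (X : Type*) [MetricSpace X] (δ : ℝ) : Prop :=
  ∀ w x y z : X, min (gromovProd w x y) (gromovProd w y z) ≤ gromovProd w x z + δ

section GromovProduct

variable {X : Type*} [MetricSpace X]

lemma gromovProd_comm (w x y : X) : gromovProd w x y = gromovProd w y x := by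
  unfold gromovProd; rw [dist_comm x y]; ring

lemma gromovProd_le_dist (w x y : X) : gromovProd w x y ≤ dist w x := by
  unfold gromovProd
  linarith [dist_triangle w x y]

lemma gromovProd_add (x y z : X) : gromovProd x y z + gromovProd y x z = dist x y := by
  unfold gromovProd
  rw [dist_comm y x]; ring

lemma gromovProd_le_add_dist (w x y y' : X) :
    gromovProd w x y ≤ gromovProd w x y' + dist y y' := by
  unfold gromovProd
  linarith [dist_triangle_right w y y', dist_triangle x y y', dist_triangle_right x y' y,
    dist_triangle w y' y, dist_comm y y']

lemma gromovProd_le_add_dist_base (w w' x y : X) :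
    gromovProd w x y ≤ gromovProd w' x y + dist w w' := by
  unfold gromovProd
  linarith [dist_triangle w w' x, dist_triangle w w' y]

lemma FourPoint.gromovProd_le {δ : ℝ} (h : FourPoint X δ) {w x y z : X} {c : ℝ}
    (hxy : gromovProd w x y ≤ c) (hyz : c + δ < gromovProd w y z) :
    gromovProd w x z ≤ c + δ := by
  have := h w x z y
  rw [gromovProd_comm w z y] at this
  rcases min_le_iff.1 this with h1 | h1 <;> linarith

/-- Points coarsely on a geodesic from `o` to `p` are close when their distances to `o` are. -/
lemma FourPoint.dist_le_of_gromovProd_le {δ C : ℝ} (h : FourPoint X δ) {o p a b : X}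
    (ha : gromovProd a o p ≤ C) (hb : gromovProd b o p ≤ C) :
    dist a b ≤ |dist o a - dist o b| + 2 * C + 2 * δ := by
  have := h o a p b
  unfold gromovProd at *
  rw [dist_comm a o] at ha
  rw [dist_comm b o] at hb
  rw [dist_comm p b] at this
  rcases min_le_iff.1 this with h1 | h1
  · linarith [neg_abs_le (dist o a - dist o b)]
  · linarith [le_abs_self (dist o a - dist o b)]

lemma IsGeodesicBetween.dist_add_dist {γ : ℝ → X} {x y q : X} (h : IsGeodesicBetween γ x y)
    (hq : q ∈ γ '' Set.Icc 0 (dist x y)) : dist x q + dist q y = dist x y := by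
  obtain ⟨t, ht, rfl⟩ := hq
  obtain ⟨h0, h1, h2⟩ := h
  have a := h2 0 ⟨le_rfl, dist_nonneg⟩ t ht
  have b := h2 t ht _ ⟨dist_nonneg, le_rfl⟩
  rw [h0] at a
  rw [h1] at b
  rw [a, b, abs_of_nonpos (by linarith [ht.1]), abs_of_nonpos (by linarith [ht.2])]
  ring

lemma IsGeodesicBetween.continuousOn {γ : ℝ → X} {x y : X} (h : IsGeodesicBetween γ x y) :
    ContinuousOn γ (Set.Icc 0 (dist x y)) := by
  have : LipschitzOnWith 1 γ (Set.Icc 0 (dist x y)) :=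
    LipschitzOnWith.of_dist_le_mul fun s hs t ht => by
      rw [h.2.2 s hs t ht, Real.dist_eq]; simp
  exact this.continuousOn

lemma IsGeodesicBetween.gromovProd_le {γ : ℝ → X} {x y q : X} (h : IsGeodesicBetween γ x y)
    (hq : q ∈ γ '' Set.Icc 0 (dist x y)) (w : X) : gromovProd w x y ≤ dist w q := by
  have := h.dist_add_dist hq
  unfold gromovProd
  linarith [dist_triangle_right w x q, dist_triangle w q y]

/-- In a thin triangle some point of a side is close to both other sides, hence realizes the
Gromov product up to an additive constant. -/
lemma GromovHyperbolic.exists_dist_le {δ : ℝ} (hX : GromovHyperbolic X δ) {γ : ℝ → X} {x z : X}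
    (hγ : IsGeodesicBetween γ x z) (w : X) :
    ∃ t ∈ Set.Icc 0 (dist x z), dist w (γ t) ≤ gromovProd w x z + 2 * (δ + 1) := by
  obtain ⟨α, hα⟩ := hX.1 x w
  obtain ⟨β, hβ⟩ := hX.1 w z
  set A := α '' Set.Icc 0 (dist x w) with hA
  set B := β '' Set.Icc 0 (dist w z) with hB
  have hxA : x ∈ A := ⟨0, ⟨le_rfl, dist_nonneg⟩, hα.1⟩
  have hzB : z ∈ B := ⟨_, ⟨dist_nonneg, le_rfl⟩, hβ.2.1⟩
  have hcont : ContinuousOn (fun t => Metric.infDist (γ t) A - Metric.infDist (γ t) B)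
      (Set.Icc 0 (dist x z)) :=
    ((Metric.continuous_infDist_pt A).comp_continuousOn hγ.continuousOn).sub
      ((Metric.continuous_infDist_pt B).comp_continuousOn hγ.continuousOn)
  have hmem : (0 : ℝ) ∈ Set.Icc (Metric.infDist (γ 0) A - Metric.infDist (γ 0) B)
      (Metric.infDist (γ (dist x z)) A - Metric.infDist (γ (dist x z)) B) := by
    rw [hγ.1, hγ.2.1, Metric.infDist_zero_of_mem hxA, Metric.infDist_zero_of_mem hzB]
    constructor <;> linarith [Metric.infDist_nonneg (x := x) (s := B),
      Metric.infDist_nonneg (x := z) (s := A)]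
  obtain ⟨t, ht, h0⟩ := intermediate_value_Icc dist_nonneg hcont hmem
  simp only at h0
  have hle : Metric.infDist (γ t) A ≤ δ ∧ Metric.infDist (γ t) B ≤ δ := by
    obtain ⟨u, hu, hd⟩ := hX.2 x w z γ α β hγ hα hβ t ht
    rcases hu with hu | hu
    · have := (Metric.infDist_le_dist_of_mem (x := γ t) hu).trans hd
      constructor <;> linarith
    · have := (Metric.infDist_le_dist_of_mem (x := γ t) hu).trans hd
      constructor <;> linarith
  obtain ⟨a, haA, ha⟩ := (Metric.infDist_lt_iff ⟨x, hxA⟩).1 (lt_of_le_of_lt hle.1 (lt_add_one δ))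
  obtain ⟨b, hbB, hb⟩ := (Metric.infDist_lt_iff ⟨z, hzB⟩).1 (lt_of_le_of_lt hle.2 (lt_add_one δ))
  have e1 := hα.dist_add_dist haA
  have e2 := hβ.dist_add_dist hbB
  have e3 := hγ.dist_add_dist ⟨t, ht, rfl⟩
  refine ⟨t, ht, ?_⟩
  unfold gromovProd
  linarith [dist_triangle_right x (γ t) a, dist_triangle (γ t) b z, dist_triangle_right w (γ t) b,
    dist_triangle_right w (γ t) a, dist_comm x w, dist_comm a w]

lemma GromovHyperbolic.fourPoint {δ : ℝ} (hX : GromovHyperbolic X δ) :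
    FourPoint X (3 * δ + 2) := by
  intro w x y z
  obtain ⟨γ, hγ⟩ := hX.1 x z
  obtain ⟨α, hα⟩ := hX.1 x y
  obtain ⟨β, hβ⟩ := hX.1 y z
  obtain ⟨t, ht, hd⟩ := hX.exists_dist_le hγ w
  obtain ⟨u, hu, hd'⟩ := hX.2 x y z γ α β hγ hα hβ t ht
  have := dist_triangle w (γ t) u
  rcases hu with hu | hu
  · exact (min_le_left _ _).trans (by linarith [hα.gromovProd_le hu w])
  · exact (min_le_right _ _).trans (by linarith [hβ.gromovProd_le hu w])

lemma FourPoint.mono {δ δ' : ℝ} (h : FourPoint X δ) (hδ : δ ≤ δ') : FourPoint X δ' :=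
  fun w x y z => (h w x y z).trans (by linarith)

/-- Given three points with pairwise small Gromov products, one of them has small Gromov product
with any two prescribed points. -/
lemma FourPoint.exists_gromovProd_le {δ C : ℝ} (h : FourPoint X δ) {o e₁ e₂ e₃ : X}
    (h₁₂ : gromovProd o e₁ e₂ ≤ C) (h₁₃ : gromovProd o e₁ e₃ ≤ C) (h₂₃ : gromovProd o e₂ e₃ ≤ C)
    (p q : X) :
    (gromovProd o p e₁ ≤ C + δ ∧ gromovProd o q e₁ ≤ C + δ) ∨
    (gromovProd o p e₂ ≤ C + δ ∧ gromovProd o q e₂ ≤ C + δ) ∨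
    (gromovProd o p e₃ ≤ C + δ ∧ gromovProd o q e₃ ≤ C + δ) := by
  have key : ∀ {a b : X}, gromovProd o a b ≤ C → ∀ x : X,
      gromovProd o x a ≤ C + δ ∨ gromovProd o x b ≤ C + δ := by
    intro a b hab x
    have := h o a x b
    rw [gromovProd_comm o a x] at this
    rcases min_le_iff.1 this with h | h
    · left; linarith
    · right; linarith
  have := key h₁₂ p
  have := key h₁₃ p
  have := key h₂₃ p
  have := key h₁₂ q
  have := key h₁₃ q
  have := key h₂₃ q
  tauto

end GromovProduct

section Action

variable {X : Type*} [MetricSpace X] {G : Type*} [Group G] [MulAction G X]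

lemma gromovProd_smul (hiso : ∀ (g : G) (x y : X), dist (g • x) (g • y) = dist x y)
    (g : G) (w x y : X) : gromovProd (g • w) (g • x) (g • y) = gromovProd w x y := by
  simp only [gromovProd, hiso]

/-- Points moved a bounded amount by `v` at both ends of a long orbit segment of `f` form a finite
set of group elements `v`. -/
lemma finite_coarse_stabilizer_orbit {δ : ℝ} (h4 : FourPoint X δ) (hδ : 0 < δ)
    (hiso : ∀ (g : G) (x y : X), dist (g • x) (g • y) = dist x y) {f : G} {o : X}
    (hf : ∀ m n : ℤ, dist (f ^ m • o) (f ^ n • o) = |(m : ℝ) - n|) (hwpd : WPD f o)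
    {R : ℝ} (hR : 0 ≤ R) :
    ∃ L : ℕ, ∀ n : ℤ, (L : ℤ) ≤ |n| →
      {v : G | dist o (v • o) ≤ R ∧ dist (f ^ n • o) (v • f ^ n • o) ≤ R}.Finite := by
  obtain ⟨L, -, hfin⟩ := hwpd (R + 2 * δ + 1) (by linarith)
  have hpos : ∀ n : ℤ, (L : ℤ) ≤ n →
      {v : G | dist o (v • o) ≤ R ∧ dist (f ^ n • o) (v • f ^ n • o) ≤ R}.Finite := by
    intro n hn
    have hnL : (L : ℝ) ≤ n := by exact_mod_cast hn
    refine hfin.subset ?_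
    rintro v ⟨h1, h2⟩
    refine ⟨by linarith, ?_⟩
    rw [mul_smul, ← zpow_natCast]
    have e1 : dist o (f ^ (L : ℤ) • o) = L := by simpa using hf 0 L
    have e2 : dist (f ^ (L : ℤ) • o) (f ^ n • o) = n - L := by
      rw [hf, abs_of_nonpos] <;> push_cast <;> linarith
    have e3 : dist o (f ^ n • o) = n := by
      have := hf 0 n
      simp only [zpow_zero, one_smul, Int.cast_zero, zero_sub, abs_neg] at this
      rw [this, abs_of_nonneg]
      exact (Nat.cast_nonneg L).trans hnL
    have e1' := (hiso v o (f ^ (L : ℤ) • o)).trans e1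
    have e2' := (hiso v (f ^ (L : ℤ) • o) (f ^ n • o)).trans e2
    have := h4 (f ^ n • o) (f ^ (L : ℤ) • o) o (v • f ^ (L : ℤ) • o)
    unfold gromovProd at this
    rw [dist_comm (f ^ n • o) (f ^ (L : ℤ) • o), dist_comm (f ^ n • o) o] at this
    have t1 := dist_triangle (f ^ n • o) (v • f ^ n • o) (v • f ^ (L : ℤ) • o)
    have t2 := dist_triangle o (v • o) (v • f ^ (L : ℤ) • o)
    have c1 := dist_comm (v • f ^ n • o) (v • f ^ (L : ℤ) • o)
    have c2 := dist_comm (f ^ (L : ℤ) • o) o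
    rcases min_le_iff.1 this with h | h <;> linarith
  refine ⟨L, fun n hn => ?_⟩
  rcases le_total 0 n with h0 | h0
  · rw [abs_of_nonneg h0] at hn
    exact hpos n hn
  · rw [abs_of_nonpos h0] at hn
    refine ((hpos (-n) hn).image fun v => f ^ n * v * f ^ (-n)).subset ?_
    rintro v ⟨h1, h2⟩
    refine ⟨f ^ (-n) * v * f ^ n, ⟨?_, ?_⟩, by group⟩
    · rw [← hiso (f ^ n), smul_smul (f ^ n) (f ^ (-n) * v * f ^ n)]
      convert h2 using 2
      rw [smul_smul]; congr 1; group
    · rw [← hiso (f ^ n), smul_smul, smul_smul, smul_smul]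
      convert h1 using 2
      · simp
      · congr 1; group

lemma finite_coarse_stabilizer {δ : ℝ} (h4 : FourPoint X δ) (hδ : 0 < δ)
    (hiso : ∀ (g : G) (x y : X), dist (g • x) (g • y) = dist x y) {f : G} {o : X}
    (hf : ∀ m n : ℤ, dist (f ^ m • o) (f ^ n • o) = |(m : ℝ) - n|) (hwpd : WPD f o)
    {R : ℝ} (hR : 0 ≤ R) :
    ∃ L : ℕ, ∀ n : ℤ, (L : ℤ) ≤ |n| → ∀ p q : X,
      {u : G | dist p (u • o) ≤ R ∧ dist q (u • f ^ n • o) ≤ R}.Finite := by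
  obtain ⟨L, hL⟩ := finite_coarse_stabilizer_orbit h4 hδ hiso hf hwpd
    (R := 2 * R) (by linarith)
  refine ⟨L, fun n hn p q => ?_⟩
  rcases Set.eq_empty_or_nonempty
    {u : G | dist p (u • o) ≤ R ∧ dist q (u • f ^ n • o) ≤ R} with h | ⟨u₀, h1, h2⟩
  · rw [h]; exact Set.finite_empty
  · refine ((hL n hn).image fun v => u₀ * v).subset ?_
    rintro u ⟨h3, h4⟩
    refine ⟨u₀⁻¹ * u, ⟨?_, ?_⟩, by group⟩
    · rw [← hiso u₀, smul_smul]
      simp only [mul_inv_cancel_left]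
      linarith [dist_triangle_left (u₀ • o) (u • o) p]
    · rw [← hiso u₀, smul_smul u₀ (u₀⁻¹ * u)]
      simp only [mul_inv_cancel_left]
      linarith [dist_triangle_left (u₀ • f ^ n • o) (u • f ^ n • o) q]

/-- If the orbit rays `f ^ (ε N)` and `g * f ^ (ε' N)` have unbounded Gromov product, the second
eventually tracks the first, with a tracking constant independent of `g`. -/
lemma exists_tracking {δ : ℝ} (h4 : FourPoint X δ) (hδ : 0 < δ)
    (hiso : ∀ (g : G) (x y : X), dist (g • x) (g • y) = dist x y) {f : G} {o : X}
    (hf : ∀ m n : ℤ, dist (f ^ m • o) (f ^ n • o) = |(m : ℝ) - n|) {ε ε' : ℤ}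
    (hε : |ε| = 1) (hε' : |ε'| = 1) {g : G}
    (has : ∀ C : ℝ, ∃ N : ℕ,
      C < gromovProd o (f ^ (ε * N) • o) (g • f ^ (ε' * N) • o)) :
    ∃ (n₀ : ℕ) (m : ℕ → ℕ), ∀ n ≥ n₀,
      dist (g • f ^ (ε' * n) • o) (f ^ (ε * m n) • o) ≤ 6 * δ + 2 ∧
      ∀ L : ℕ, |(m (n + L) : ℝ) - m n - L| ≤ 6 * δ + 2 := by
  have habs : ∀ e : ℤ, |e| = 1 → ∀ a b : ℕ,
      dist (f ^ (e * a) • o) (f ^ (e * b) • o) = |(a : ℝ) - b| := by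
    intro e he a b
    have h1 : |(e : ℝ)| = 1 := by exact_mod_cast congrArg (Int.cast : ℤ → ℝ) he
    rw [hf]
    push_cast
    rw [← mul_sub, abs_mul, h1, one_mul]
  have habs0 : ∀ e : ℤ, |e| = 1 → ∀ a : ℕ, dist o (f ^ (e * a) • o) = a := by
    intro e he a
    simpa using habs e he 0 a
  set T := dist o (g • o) with hT
  set q : ℕ → X := fun n => g • f ^ (ε' * n) • o with hq
  have hqq : ∀ a b : ℕ, dist (q a) (q b) = |(a : ℝ) - b| := fun a b => by
    rw [hq]; simp only [hiso]; exact habs ε' hε' a b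
  have hgq : ∀ a : ℕ, dist (g • o) (q a) = a := fun a => by
    rw [hq]; simp only [hiso]; exact habs0 ε' hε' a
  have hback : ∀ n N : ℕ, T + δ < n → n ≤ N → gromovProd (q n) o (q N) ≤ δ := by
    intro n N hn hN
    have hN' : (n : ℝ) ≤ N := by exact_mod_cast hN
    have h0 : gromovProd (q n) (g • o) (q N) ≤ 0 := by
      unfold gromovProd
      rw [dist_comm (q n) (g • o), hgq, hgq, hqq, abs_of_nonpos (by linarith)]
      linarith
    have := h4 (q n) (g • o) o (q N)
    rcases min_le_iff.1 this with h | h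
    · unfold gromovProd at h h0
      linarith [hgq n, dist_comm (q n) (g • o), dist_comm (g • o) o,
        dist_triangle (q n) o (g • o)]
    · linarith
  obtain ⟨n₀, hn₀⟩ := exists_nat_gt (T + δ)
  refine ⟨n₀, fun n => ⌊dist o (q n)⌋₊, fun n hn => ⟨?_, fun L => ?_⟩⟩
  · have hn' : T + δ < n := hn₀.trans_le (by exact_mod_cast hn)
    obtain ⟨N, hN⟩ := has (T + 2 * n + 2 * δ)
    set b := f ^ (ε * N) • o with hb
    have hT0 : 0 ≤ T := dist_nonneg
    have hbN : dist o b = N := habs0 ε hε N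
    have hNbig : T + 2 * n + 2 * δ < N := by
      have := gromovProd_le_dist o b (q N)
      rw [hbN] at this
      exact hN.trans_le this
    have hoq : dist o (q n) ≤ T + n := by linarith [dist_triangle o (g • o) (q n), hgq n]
    have hnN : n ≤ N := by
      have : (n : ℝ) ≤ N := by linarith [(Nat.cast_nonneg n : (0 : ℝ) ≤ n)]
      exact_mod_cast this
    have h1 := hback n N hn' hnN
    have h2 := gromovProd_le_add_dist_base o (q n) b (q N)
    have h3 : gromovProd (q n) o b ≤ δ + δ :=
      h4.gromovProd_le h1 (by
        rw [gromovProd_comm]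
        have : (0 : ℝ) ≤ n := Nat.cast_nonneg n
        change _ < gromovProd o b (q N) at hN
        linarith)
    set m := ⌊dist o (q n)⌋₊ with hm
    have hm1 : (m : ℝ) ≤ dist o (q n) := Nat.floor_le dist_nonneg
    have hm2 : dist o (q n) < m + 1 := Nat.lt_floor_add_one _
    have h5 : gromovProd (f ^ (ε * m) • o) o b ≤ δ + δ := by
      unfold gromovProd
      rw [dist_comm (f ^ (ε * m) • o) o, habs0 ε hε, hb, habs0 ε hε, habs ε hε,
        abs_of_nonpos (by linarith [(Nat.cast_nonneg n : (0 : ℝ) ≤ n)])]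
      linarith
    have := h4.dist_le_of_gromovProd_le h3 h5
    rw [habs0 ε hε, abs_of_nonneg (by linarith)] at this
    change dist (q n) _ ≤ _
    linarith
  · have hn' : T + δ < n := hn₀.trans_le (by exact_mod_cast hn)
    have h1 := hback n (n + L) hn' (Nat.le_add_right _ _)
    have h2 := hqq n (n + L)
    rw [abs_of_nonpos (by push_cast; linarith [(Nat.cast_nonneg L : (0 : ℝ) ≤ L)])] at h2
    push_cast at h2
    unfold gromovProd at h1
    rw [dist_comm (q n) o] at h1
    have h3 := dist_triangle o (q n) (q (n + L))
    have a1 := Nat.floor_le (dist_nonneg (x := o) (y := q n))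
    have a2 := Nat.lt_floor_add_one (dist o (q n))
    have a3 := Nat.floor_le (dist_nonneg (x := o) (y := q (n + L)))
    have a4 := Nat.lt_floor_add_one (dist o (q (n + L)))
    rw [abs_le]
    constructor <;> linarith

/-- A group covered by finitely many double cosets `⟨f⟩ φ ⟨f⟩` with `φ` commensurating `⟨f⟩` is
virtually cyclic. -/
lemma virtuallyCyclic_of_finite_doubleCosets {f : G} {Φ : Set G} (hΦ : Φ.Finite)
    (h : ∀ g : G, ∃ φ ∈ Φ, ∃ a b p c : ℤ, p ≠ 0 ∧ g = f ^ a * φ * f ^ b ∧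
      φ * f ^ p = f ^ c * φ) : VirtuallyCyclic G := by
  classical
  set P : G → ℤ → Prop := fun φ p => p ≠ 0 ∧ ∃ c : ℤ, φ * f ^ p = f ^ c * φ with hP
  have hex : ∀ φ : G, ∃ p : ℤ, (∃ q, P φ q) → P φ p := fun φ => by
    by_cases hq : ∃ q, P φ q
    · exact ⟨hq.choose, fun _ => hq.choose_spec⟩
    · exact ⟨0, fun h => (hq h).elim⟩
  choose p hp using hex
  set J : Set G := ⋃ φ ∈ Φ, (fun i : ℤ => φ * f ^ i) '' Set.Ico 0 |p φ| with hJ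
  have hJfin : J.Finite := hΦ.biUnion fun φ _ => (Set.finite_Ico _ _).image _
  have hcover : ∀ g : G, ∃ j ∈ J, ∃ a : ℤ, g = f ^ a * j := by
    intro g
    obtain ⟨φ, hφ, a, b, p', c', hp', rfl, hc'⟩ := h g
    obtain ⟨hp0, c, hc⟩ := hp φ ⟨p', hp', c', hc'⟩
    have hcz : ∀ z : ℤ, φ * f ^ (p φ * z) = f ^ (c * z) * φ := by
      intro z
      have h1 : f ^ c = φ * f ^ p φ * φ⁻¹ := by rw [hc]; group
      rw [zpow_mul, zpow_mul, h1, conj_zpow]; group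
    refine ⟨φ * f ^ (b % p φ), ?_, a + c * (b / p φ), ?_⟩
    · exact Set.mem_biUnion hφ ⟨_, ⟨Int.emod_nonneg _ hp0, Int.emod_lt_abs _ hp0⟩, rfl⟩
    · have h2 := hcz (b / p φ)
      calc f ^ a * φ * f ^ b = f ^ a * φ * f ^ (p φ * (b / p φ) + b % p φ) := by
            rw [Int.mul_ediv_add_emod]
        _ = f ^ a * (φ * f ^ (p φ * (b / p φ))) * f ^ (b % p φ) := by rw [zpow_add]; group
        _ = _ := by rw [h2, zpow_add]; group
  refine ⟨Subgroup.zpowers f, ?_, inferInstance⟩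
  have : Finite J := hJfin
  have hsurj : Function.Surjective
      (fun j : J => (QuotientGroup.mk (j : G)⁻¹ : G ⧸ Subgroup.zpowers f)) := by
    intro x
    induction x using QuotientGroup.induction_on with
    | H g =>
      obtain ⟨j, hj, a, ha⟩ := hcover g⁻¹
      refine ⟨⟨j, hj⟩, ?_⟩
      rw [QuotientGroup.eq]
      refine ⟨-a, ?_⟩
      have : g = j⁻¹ * f ^ (-a) := by rw [← inv_inv g, ha]; group
      rw [this]; group
  have := Finite.of_surjective _ hsurj
  exact Subgroup.finiteIndex_of_finite_quotient

/-- In a non-virtually-cyclic group, some translate of the axis of `f` shares no endpoint with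
the axis. -/
lemma exists_independent_translate {δ : ℝ} (h4 : FourPoint X δ) (hδ : 0 < δ)
    (hiso : ∀ (g : G) (x y : X), dist (g • x) (g • y) = dist x y) {f : G} {o : X}
    (hf : ∀ m n : ℤ, dist (f ^ m • o) (f ^ n • o) = |(m : ℝ) - n|) (hwpd : WPD f o)
    (hnvc : ¬ VirtuallyCyclic G) :
    ∃ (g : G) (C : ℝ), ∀ ε ε' : ℤ, |ε| = 1 → |ε'| = 1 → ∀ N : ℕ,
      gromovProd o (f ^ (ε * N) • o) (g • f ^ (ε' * N) • o) ≤ C := by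
  by_contra! hcon
  have hasym : ∀ g : G, ∃ ε ε' : ℤ, |ε| = 1 ∧ |ε'| = 1 ∧ ∀ C : ℝ, ∃ N : ℕ,
      C < gromovProd o (f ^ (ε * N) • o) (g • f ^ (ε' * N) • o) := by
    intro g
    by_contra! hg
    have hg' : ∀ ε ε' : ℤ, ∃ C : ℝ, |ε| = 1 → |ε'| = 1 → ∀ N : ℕ,
        gromovProd o (f ^ (ε * N) • o) (g • f ^ (ε' * N) • o) ≤ C := by
      intro ε ε'
      by_cases h1 : |ε| = 1
      · by_cases h2 : |ε'| = 1
        · obtain ⟨C, hC⟩ := hg ε ε' h1 h2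
          exact ⟨C, fun _ _ => hC⟩
        · exact ⟨0, fun _ h => (h2 h).elim⟩
      · exact ⟨0, fun h => (h1 h).elim⟩
    choose C hC using hg'
    obtain ⟨ε, ε', h1, h2, N, hN⟩ :=
      hcon g (max (max (C 1 1) (C 1 (-1))) (max (C (-1) 1) (C (-1) (-1))))
    refine absurd hN (not_lt.2 ((hC ε ε' h1 h2 N).trans ?_))
    rcases (abs_eq zero_le_one).1 h1 with rfl | rfl <;>
      rcases (abs_eq zero_le_one).1 h2 with rfl | rfl <;> simp
  obtain ⟨L, hL⟩ := finite_coarse_stabilizer h4 hδ hiso hf hwpd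
    (R := 2 * (6 * δ + 2)) (by linarith)
  set Ψ : ℤ → ℤ → Set G := fun ε ε' => {u : G | dist o (u • o) ≤ 2 * (6 * δ + 2) ∧
    dist (f ^ (ε * L) • o) (u • f ^ (ε' * L) • o) ≤ 2 * (6 * δ + 2)} with hΨ
  have hΨfin : ∀ ε ε' : ℤ, |ε'| = 1 → (Ψ ε ε').Finite := fun ε ε' h =>
    hL (ε' * L) (by rw [abs_mul, h]; simp) o _
  refine hnvc (virtuallyCyclic_of_finite_doubleCosets (f := f)
    (Φ := ⋃ ε ∈ ({1, -1} : Set ℤ), ⋃ ε' ∈ ({1, -1} : Set ℤ), Ψ ε ε') ?_ ?_)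
  · refine (Set.toFinite _).biUnion fun ε _ => (Set.toFinite _).biUnion fun ε' hε' => ?_
    exact hΨfin ε ε' (by rcases hε' with rfl | rfl <;> simp)
  · intro g
    obtain ⟨ε, ε', hε, hε', has⟩ := hasym g
    obtain ⟨n₀, m, hm⟩ := exists_tracking h4 hδ hiso hf hε hε' has
    set u : ℕ → G := fun n => f ^ (-(ε * m n)) * g * f ^ (ε' * n) with hu
    have hmem : ∀ n ≥ n₀, u n ∈ Ψ ε ε' := by
      intro n hn
      refine ⟨?_, ?_⟩
      · rw [← hiso (f ^ (ε * m n)), smul_smul _ (u n)]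
        have : f ^ (ε * m n) * u n = g * f ^ (ε' * n) := by rw [hu]; group
        rw [this, mul_smul, dist_comm]
        linarith [(hm n hn).1]
      · rw [← hiso (f ^ (ε * m n)), smul_smul _ (u n), smul_smul, smul_smul]
        have e1 : f ^ (ε * m n) * u n * f ^ (ε' * L) = g * f ^ (ε' * (n + L : ℕ)) := by
          rw [hu]; push_cast; rw [mul_add, zpow_add]; group
        have e2 : f ^ (ε * m n) * f ^ (ε * L) = f ^ (ε * (m n + L)) := by
          rw [← zpow_add, ← mul_add]
        rw [e1, e2, mul_smul]
        have h1 := (hm (n + L) (by omega)).1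
        have h2 := (hm n hn).2 L
        have h3 : dist (f ^ (ε * (m n + L)) • o) (f ^ (ε * m (n + L)) • o) ≤ 6 * δ + 2 := by
          have hεr : |(ε : ℝ)| = 1 := by exact_mod_cast congrArg (Int.cast : ℤ → ℝ) hε
          rw [hf]
          push_cast
          rw [← mul_sub, abs_mul, hεr, one_mul, abs_sub_comm, ← sub_sub]
          exact h2
        linarith [dist_triangle_right (f ^ (ε * (m n + L)) • o) (g • f ^ (ε' * (n + L : ℕ)) • o)
          (f ^ (ε * m (n + L)) • o)]
    have : Finite (Ψ ε ε') := hΨfin ε ε' hε'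
    obtain ⟨i, j, hij, he⟩ := Finite.exists_ne_map_eq_of_infinite
      (fun k : ℕ => (⟨u (n₀ + k), hmem _ (by omega)⟩ : Ψ ε ε'))
    have he' : u (n₀ + i) = u (n₀ + j) := congrArg Subtype.val he
    have hpm : ∀ e : ℤ, |e| = 1 → e ∈ ({1, -1} : Set ℤ) := fun e he => (abs_eq zero_le_one).1 he
    refine ⟨u (n₀ + i), ?_, ε * m (n₀ + i), -(ε' * (n₀ + i : ℕ)), ε' * (j - i),
      ε * (m (n₀ + j) - m (n₀ + i)), ?_, ?_, ?_⟩
    · exact Set.mem_biUnion (hpm ε hε) (Set.mem_biUnion (hpm ε' hε') (hmem _ (by omega)))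
    · refine mul_ne_zero (by rintro rfl; simp at hε') ?_
      rw [sub_ne_zero]; exact_mod_cast hij.symm
    · rw [hu]; group
    · have e1 : u (n₀ + i) * f ^ (ε' * ((j : ℤ) - i)) =
          f ^ (-(ε * m (n₀ + i))) * g * f ^ (ε' * (n₀ + j : ℕ)) := by
        rw [hu]; simp only [mul_assoc, ← zpow_add]
        congr 3; push_cast; ring
      have e2 : f ^ (ε * ((m (n₀ + j) : ℤ) - m (n₀ + i))) * u (n₀ + j) =
          f ^ (-(ε * m (n₀ + i))) * g * f ^ (ε' * (n₀ + j : ℕ)) := by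
        rw [hu]; simp only [← mul_assoc, ← zpow_add]
        congr 3; ring
      rw [e1, he', e2]

/-- Markers: for every large `N` there is a finite set of group elements of length about `N`,
flexible enough to avoid prescribed directions on both sides, whose coarse coincidences form a
finite set. -/
lemma exists_markers {δ : ℝ} (h4 : FourPoint X δ) (hδ : 0 < δ)
    (hiso : ∀ (g : G) (x y : X), dist (g • x) (g • y) = dist x y) {f : G} {o : X}
    (hf : ∀ m n : ℤ, dist (f ^ m • o) (f ^ n • o) = |(m : ℝ) - n|) (hwpd : WPD f o)
    (hnvc : ¬ VirtuallyCyclic G) :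
    ∃ C : ℝ, 0 ≤ C ∧ ∀ R : ℝ, 0 ≤ R → ∃ N₀ : ℕ, ∀ N ≥ N₀, ∃ F : Set G, F.Finite ∧
      (∀ h ∈ F, |dist o (h • o) - N| ≤ C) ∧
      (∀ p q z : X, ∃ h ∈ F, gromovProd o p (h • o) ≤ C ∧ gromovProd o q (h • o) ≤ C ∧
        gromovProd o z (h⁻¹ • o) ≤ C) ∧
      {γ : G | dist o (γ • o) ≤ R ∧
        ∃ h ∈ F, ∃ h' ∈ F, dist (h • o) (γ • h' • o) ≤ R}.Finite := by
  obtain ⟨g, C₀, hg⟩ := exists_independent_translate h4 hδ hiso hf hwpd hnvc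
  set T := dist o (g • o) with hT
  have hT0 : 0 ≤ T := dist_nonneg
  set E : Set G := {1, g} with hE
  have hET : ∀ k ∈ E, dist o (k • o) ≤ T := by
    rintro k (rfl | rfl)
    · simpa using hT0
    · exact le_rfl
  have hET' : ∀ k ∈ E, dist o (k⁻¹ • o) ≤ T := by
    intro k hk
    rw [← hiso k, smul_inv_smul, dist_comm]
    exact hET k hk
  have hf0 : ∀ n : ℤ, dist o (f ^ n • o) = |(n : ℝ)| := fun n => by simpa using hf 0 n
  have hC₀ : 0 ≤ C₀ := by
    have := hg 1 1 rfl rfl 0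
    simp only [Nat.cast_zero, mul_zero, zpow_zero, one_smul] at this
    unfold gromovProd at this
    simpa using this
  refine ⟨C₀ + δ + 2 * T, by linarith, fun R hR => ?_⟩
  obtain ⟨L, hL⟩ := finite_coarse_stabilizer h4 hδ hiso hf hwpd (R := R + 2 * T) (by linarith)
  refine ⟨L, fun N hN => ?_⟩
  set F : Set G := ⋃ k ∈ E, ⋃ n ∈ ({(N : ℤ), -(N : ℤ)} : Set ℤ), (fun k' => k * f ^ n * k'⁻¹) '' E
    with hF
  have hEfin : E.Finite := Set.toFinite _
  have hmem : ∀ h ∈ F, ∃ k ∈ E, ∃ n ∈ ({(N : ℤ), -(N : ℤ)} : Set ℤ),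
      dist (h • o) (k • f ^ n • o) ≤ T := by
    intro h hh
    simp only [hF, Set.mem_iUnion] at hh
    obtain ⟨k, hk, n, hn, k', hk', rfl⟩ := hh
    refine ⟨k, hk, n, hn, ?_⟩
    rw [mul_smul, mul_smul, hiso, hiso, dist_comm]
    exact hET' k' hk'
  have habs : ∀ n ∈ ({(N : ℤ), -(N : ℤ)} : Set ℤ), |n| = N := by
    rintro n (rfl | rfl) <;> simp
  refine ⟨F, ?_, ?_, ?_, ?_⟩
  · exact hEfin.biUnion fun k _ => (Set.toFinite _).biUnion fun n _ => hEfin.image _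
  · intro h hh
    obtain ⟨k, hk, n, hn, hd⟩ := hmem h hh
    have e1 : dist (k • o) (k • f ^ n • o) = N := by
      rw [hiso, hf0]; exact_mod_cast habs n hn
    have e2 := hET k hk
    rw [abs_le]
    constructor
    · linarith [dist_triangle_left (k • o) (k • f ^ n • o) o, dist_triangle o (h • o)
        (k • f ^ n • o)]
    · linarith [dist_triangle o (k • o) (h • o), dist_triangle_right (k • o) (h • o)
        (k • f ^ n • o)]
  · have hsel : ∀ p q : X, ∃ k ∈ E, ∃ ε : ℤ, |ε| = 1 ∧
        gromovProd o p (k • f ^ (ε * N) • o) ≤ C₀ + δ ∧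
        gromovProd o q (k • f ^ (ε * N) • o) ≤ C₀ + δ := by
      intro p q
      have h12 : gromovProd o (f ^ ((1 : ℤ) * N) • o) (f ^ ((-1 : ℤ) * N) • o) ≤ C₀ := by
        unfold gromovProd
        rw [hf0, hf0, hf]
        push_cast
        rw [one_mul, neg_one_mul, abs_neg, sub_neg_eq_add, abs_of_nonneg (by positivity),
          abs_of_nonneg (by positivity)]
        linarith
      rcases h4.exists_gromovProd_le h12 (hg 1 1 rfl rfl N) (hg (-1) 1 rfl rfl N) p q with
        h | h | h
      · exact ⟨1, Or.inl rfl, 1, rfl, by simpa only [one_smul] using h⟩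
      · exact ⟨1, Or.inl rfl, -1, rfl, by simpa only [one_smul] using h⟩
      · exact ⟨g, Or.inr rfl, 1, rfl, h⟩
    have hsel' : ∀ (z : X) (ε : ℤ), |ε| = 1 → ∃ k ∈ E,
        gromovProd o z (k • f ^ (ε * N) • o) ≤ C₀ + δ := by
      intro z ε hε
      have := h4 o (f ^ (ε * N) • o) z (g • f ^ (ε * N) • o)
      rw [gromovProd_comm o _ z] at this
      rcases min_le_iff.1 (this.trans (add_le_add_left (hg ε ε hε hε N) δ)) with h | h
      · exact ⟨1, Or.inl rfl, by simpa only [one_smul] using h⟩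
      · exact ⟨g, Or.inr rfl, h⟩
    intro p q z
    obtain ⟨k, hk, ε, hε, h1, h2⟩ := hsel p q
    obtain ⟨k', hk', h3⟩ := hsel' z (-ε) (by rwa [abs_neg])
    have hd : dist ((k * f ^ (ε * N) * k'⁻¹) • o) (k • f ^ (ε * N) • o) ≤ T := by
      rw [mul_smul, mul_smul, hiso, hiso, dist_comm]
      exact hET' k' hk'
    have hd' : dist ((k * f ^ (ε * N) * k'⁻¹)⁻¹ • o) (k' • f ^ (-ε * N) • o) ≤ T := by
      have : (k * f ^ (ε * N) * k'⁻¹)⁻¹ = k' * f ^ (-ε * N) * k⁻¹ := by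
        rw [neg_mul]; group
      rw [this, mul_smul, mul_smul, hiso, hiso, dist_comm]
      exact hET' k hk
    refine ⟨k * f ^ (ε * N) * k'⁻¹, ?_, ?_, ?_, ?_⟩
    · refine Set.mem_biUnion hk (Set.mem_biUnion (x := ε * N) ?_ ⟨k', hk', rfl⟩)
      rcases (abs_eq zero_le_one).1 hε with rfl | rfl <;> simp
    · linarith [gromovProd_le_add_dist o p ((k * f ^ (ε * N) * k'⁻¹) • o) (k • f ^ (ε * N) • o),
        gromovProd_comm o p ((k * f ^ (ε * N) * k'⁻¹) • o)]
    · linarith [gromovProd_le_add_dist o q ((k * f ^ (ε * N) * k'⁻¹) • o) (k • f ^ (ε * N) • o)]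
    · linarith [gromovProd_le_add_dist o z ((k * f ^ (ε * N) * k'⁻¹)⁻¹ • o)
        (k' • f ^ (-ε * N) • o)]
  · have hfin : (⋃ k ∈ E, ⋃ n ∈ ({(N : ℤ), -(N : ℤ)} : Set ℤ), ⋃ k' ∈ E,
        ⋃ n' ∈ ({(N : ℤ), -(N : ℤ)} : Set ℤ), (fun u => u * k'⁻¹) ''
          {u : G | dist o (u • o) ≤ R + 2 * T ∧
            dist (k • f ^ n • o) (u • f ^ n' • o) ≤ R + 2 * T}).Finite := by
      refine hEfin.biUnion fun k _ => (Set.toFinite _).biUnion fun n _ =>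
        hEfin.biUnion fun k' _ => (Set.toFinite _).biUnion fun n' hn' => ?_
      exact (hL n' (by rw [habs n' hn']; exact_mod_cast hN) o (k • f ^ n • o)).image _
    refine hfin.subset ?_
    rintro γ ⟨h1, h, hh, h', hh', h2⟩
    obtain ⟨k, hk, n, hn, hd⟩ := hmem h hh
    obtain ⟨k', hk', n', hn', hd'⟩ := hmem h' hh'
    refine Set.mem_biUnion hk (Set.mem_biUnion hn (Set.mem_biUnion hk' (Set.mem_biUnion hn'
      ⟨γ * k', ⟨?_, ?_⟩, by group⟩)))
    · rw [mul_smul]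
      linarith [dist_triangle o (γ • o) (γ • k' • o), hiso γ o (k' • o), hET k' hk']
    · rw [mul_smul]
      linarith [hiso γ (h' • o) (k' • f ^ n' • o),
        dist_triangle4_left (h • o) (k • f ^ n • o) (γ • h' • o) (γ • k' • f ^ n' • o),
        dist_triangle_left (k • f ^ n • o) (γ • k' • f ^ n' • o) (h • o),
        dist_triangle (h • o) (γ • h' • o) (γ • k' • f ^ n' • o)]

end Action

section Barriers

variable {X : Type*} [MetricSpace X]

/-- `b` lies coarsely behind `a` as seen from `o`, at least `D` further away. -/
def Beyond (o : X) (C D : ℝ) (a b : X) : Prop :=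
  gromovProd a o b ≤ C ∧ dist o a + D ≤ dist o b

lemma FourPoint.eq_or_gromovProd_le_of_reflTransGen {δ C D : ℝ} (h4 : FourPoint X δ) (hδ : 0 < δ)
    (hD : 2 * C + 4 * δ < D) {o a b : X} (h : Relation.ReflTransGen (Beyond o C D) a b) :
    a = b ∨ gromovProd a o b ≤ C + δ := by
  induction h using Relation.ReflTransGen.head_induction_on with
  | refl => exact Or.inl rfl
  | head hac _ ih =>
    rename_i a c _
    right
    rcases ih with rfl | ih
    · linarith [hac.1]
    have hd : D ≤ dist a c := by linarith [hac.2, dist_triangle o a c]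
    have h1 : gromovProd c a b ≤ C + δ + δ := by
      rw [gromovProd_comm] at ih ⊢
      refine h4.gromovProd_le ih ?_
      linarith [gromovProd_add c o a, gromovProd_add a o c, gromovProd_comm c o a, hac.1,
        dist_comm c a, gromovProd_add a c o, gromovProd_comm a c o]
    refine h4.gromovProd_le hac.1 ?_
    linarith [gromovProd_add c a b, gromovProd_add a c b]

lemma FourPoint.le_gromovProd_of_gromovProd_le {δ C A : ℝ} (h4 : FourPoint X δ) (hC : 0 ≤ C)
    {o a p y : X} (h : gromovProd a o p ≤ C) (hA : A ≤ gromovProd o a y) :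
    A - C - δ ≤ gromovProd o p y := by
  have h1 := h4 o p a y
  have h2 := gromovProd_le_dist o a y
  have h3 := gromovProd_add a o p
  rw [gromovProd_comm o p a] at h1
  rcases min_le_iff.1 h1 with h | h <;> linarith [dist_comm o a]

lemma FourPoint.gromovProd_le_of_local {δ C : ℝ} (h4 : FourPoint X δ) {o a b p : X}
    (hab : 2 * C + 2 * δ < dist a b) (h₁ : gromovProd a o b ≤ C)
    (h₂ : gromovProd b a p ≤ C + δ) :
    gromovProd a o p ≤ C + δ ∧ gromovProd b o p ≤ C + 2 * δ := by
  have e1 := gromovProd_add a b p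
  have e2 := gromovProd_add a b o
  have e3 := gromovProd_comm a o b
  refine ⟨h4.gromovProd_le h₁ (by linarith), ?_⟩
  rw [gromovProd_comm] at h₂ ⊢
  have := h4.gromovProd_le (z := o) h₂ (by linarith)
  linarith

/-- If `a'` lies coarsely on the way from `o` to `p`, well after `a`, and the way from `a` to `p`
starts towards `b`, a direction avoiding `y`, then `a` and `a'` have similar projections to
`[o, y]`. -/
lemma FourPoint.abs_gromovProd_sub_le {δ C D : ℝ} (h4 : FourPoint X δ) (hδ : 0 < δ) (hC : 0 ≤ C)
    {o a a' b p y : X} (ha : gromovProd a o p ≤ C + δ) (ha' : gromovProd a' o p ≤ C + δ)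
    (hD : 2 * C + 4 * δ < D) (haa' : dist o a + D ≤ dist o a')
    (hb : gromovProd b a p ≤ C + δ) (hab : 2 * C + 4 * δ < dist a b)
    (hy : gromovProd a y b ≤ C) :
    gromovProd a o a' ≤ C + 2 * δ ∧ |gromovProd o a' y - gromovProd o a y| ≤ C + 3 * δ := by
  have h1 : gromovProd a o a' ≤ C + 2 * δ := by
    have := h4.dist_le_of_gromovProd_le ha ha'
    rw [abs_of_nonpos (by linarith)] at this
    unfold gromovProd
    rw [dist_comm a o]
    linarith
  refine ⟨h1, ?_⟩
  have e1 := gromovProd_add a b p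
  have h2 : C + 2 * δ < gromovProd a a' p := by
    unfold gromovProd at ha ha' ⊢
    linarith [dist_triangle o a a', dist_triangle o a p, dist_comm a o, dist_comm a' o]
  have h3 : C + δ < gromovProd a b a' := by
    have := h4 a b p a'
    rw [gromovProd_comm a p a'] at this
    rcases min_le_iff.1 this with h | h <;> linarith
  have h5 : gromovProd a y a' ≤ C + δ := h4.gromovProd_le hy h3
  have h6 := h4.le_gromovProd_of_gromovProd_le (y := y) (A := gromovProd o a y) (by linarith) h1
    le_rfl
  rw [abs_le]
  constructor
  · linarith
  · unfold gromovProd at h5 ⊢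
    linarith [dist_triangle o a a', dist_comm a y, dist_comm a' y]

variable {G : Type*} [Group G]

lemma finite_setOf_wordNorm_le_one {S : Finset G} (hgen : Subgroup.closure (S : Set G) = ⊤) :
    {g : G | wordNorm S g ≤ 1}.Finite := by
  refine (((Finset.finite_toSet S).union (Finset.finite_toSet S).inv).union
    (Set.finite_singleton 1)).subset ?_
  intro g hg
  obtain ⟨l₀, hl₀, hp₀⟩ := Submonoid.exists_list_of_mem_closure
    (show g ∈ Submonoid.closure ((S : Set G) ∪ (S : Set G)⁻¹) by
      rw [← Subgroup.closure_toSubmonoid, hgen]; trivial)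
  have hne : {n : ℕ | ∃ l : List G, l.length = n ∧ (∀ x ∈ l, x ∈ S ∨ x⁻¹ ∈ S) ∧
      l.prod = g}.Nonempty := ⟨_, l₀, rfl, hl₀, hp₀⟩
  obtain ⟨l, hl, hS, rfl⟩ := Nat.sInf_mem hne
  have hl1 : l.length ≤ 1 := hl.le.trans hg
  match l, hl1 with
  | [], _ => right; simp
  | [a], _ => left; simpa using hS a (by simp)

/-- Maximal `Ψ`-separated subsets are `Ψ`-dense. -/
lemma exists_separated_net {Ψ : Set G} (hinv : ∀ γ ∈ Ψ, γ⁻¹ ∈ Ψ) (hone : 1 ∈ Ψ) (B : Set G) :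
    ∃ A ⊆ B, (∀ a ∈ A, ∀ b ∈ A, a⁻¹ * b ∈ Ψ → a = b) ∧ ∀ b ∈ B, ∃ a ∈ A, b⁻¹ * a ∈ Ψ := by
  obtain ⟨A, hA⟩ := zorn_subset {A : Set G | A ⊆ B ∧ ∀ a ∈ A, ∀ b ∈ A, a⁻¹ * b ∈ Ψ → a = b} (by
    intro c hc hchain
    refine ⟨⋃₀ c, ⟨Set.sUnion_subset fun s hs => (hc hs).1, ?_⟩,
      fun s hs => Set.subset_sUnion_of_mem hs⟩
    rintro a ⟨s, hs, has⟩ b ⟨t, ht, hbt⟩ hab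
    rcases hchain.total hs ht with h | h
    · exact (hc ht).2 a (h has) b hbt hab
    · exact (hc hs).2 a has b (h hbt) hab)
  refine ⟨A, hA.prop.1, hA.prop.2, fun b hb => ?_⟩
  by_contra! hcon
  have hbA : b ∉ A := fun h => hcon b h (by simpa using hone)
  have hcon' : ∀ a ∈ A, a⁻¹ * b ∉ Ψ := fun a ha h => hcon a ha (by simpa using hinv _ h)
  refine hbA (hA.le_of_ge (y := insert b A) ⟨Set.insert_subset hb hA.prop.1, ?_⟩
    (Set.subset_insert b A) (Set.mem_insert b A))
  rintro x (rfl | hx) z (rfl | hz) hxz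
  · rfl
  · exact (hcon z hz hxz).elim
  · exact (hcon' x hx hxz).elim
  · exact hA.prop.2 x hx z hz hxz

/-- Unique factorization over a set can be checked on the first letter. -/
lemma list_eq_of_prod_eq {B : Set G}
    (h : ∀ b ∈ B, ∀ b' ∈ B, ∀ l l' : List G, (∀ x ∈ l, x ∈ B) → (∀ x ∈ l', x ∈ B) →
      b * l.prod = b' * l'.prod → b = b') :
    ∀ l l' : List G, l.length = l'.length → (∀ x ∈ l, x ∈ B) → (∀ x ∈ l', x ∈ B) →
      l.prod = l'.prod → l = l'
  | [], [], _, _, _, _ => rfl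
  | b :: l, b' :: l', hlen, hl, hl', hp => by
    simp only [List.prod_cons, List.mem_cons, forall_eq_or_imp] at hp hl hl'
    obtain rfl := h b hl.1 b' hl'.1 l l' hl.2 hl'.2 hp
    rw [list_eq_of_prod_eq h l l' (by simpa using hlen) hl.2 hl'.2 (mul_left_cancel hp)]

end Barriers

/-- An isometry translating a geodesic line by `1` translates it by integers under its powers. -/
lemma zpow_smul_axis {X G : Type*} [Group G] [MulAction G X] {f : G} {ℓ : ℝ → X}
    (haxis : ∀ t : ℝ, f • ℓ t = ℓ (t + 1)) (n : ℤ) : ∀ t : ℝ, f ^ n • ℓ t = ℓ (t + n) := by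
  induction n using Int.induction_on with
  | zero => simp
  | succ n ih => intro t; rw [zpow_add_one, mul_smul, haxis, ih]; push_cast; congr 1; ring
  | pred n ih =>
    intro t
    have h : f⁻¹ • ℓ t = ℓ (t - 1) := by rw [inv_smul_eq_iff, haxis]; congr 1; ring
    rw [zpow_sub_one, mul_smul, h, ih]; push_cast; congr 1; ring

/-- **Branching barriers for Gromov-product halfspaces** (Proposition 6.1 of the paper).
Here `𝓗_R(x₀, y) = {z : (z|y)_{x₀} > R}`. -/
theorem branching_barriers_for_halfspaces
    {X : Type*} [MetricSpace X] {G : Type*} [Group G] [MulAction G X]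
    (δ : ℝ) (hX : GromovHyperbolic X δ)
    (hiso : ∀ (g : G) (x y : X), dist (g • x) (g • y) = dist x y)
    (hnvc : ¬ VirtuallyCyclic G)
    (f : G) (ℓ : ℝ → X) (hgeo : ∀ s t : ℝ, dist (ℓ s) (ℓ t) = |s - t|)
    (haxis : ∀ t : ℝ, f • ℓ t = ℓ (t + 1))
    (x₀ : X) (hx₀ : x₀ ∈ Set.range ℓ) (hwpd : WPD f x₀)
    (S : Finset G) (hgen : Subgroup.closure (S : Set G) = ⊤) :
    ∃ r : ℝ, 0 < r ∧ ∀ R : ℝ, 0 < R → ∀ y : X,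
      ∃ B : ℕ → Set G,
        (∀ i ∈ Finset.Icc 1 ⌊R / r⌋₊, ∀ j ∈ Finset.Icc 1 ⌊R / r⌋₊, i ≠ j →
          Disjoint (B i) (B j)) ∧
        RoughlyBranching S r (⋃ i ∈ Finset.Icc 1 ⌊R / r⌋₊, B i) ∧
        ∀ i ∈ Finset.Icc 1 ⌊R / r⌋₊,
          ∀ g : G, R < gromovProd x₀ (g • x₀) y →
            ∀ (n : ℕ) (γ : ℕ → G), γ 0 = 1 → γ n = g →
              (∀ k < n, wordDist S (γ k) (γ (k + 1)) ≤ 1) → ∃ t ≤ n, γ t ∈ B i := by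
  classical
  obtain ⟨δ', hδ, h4⟩ : ∃ δ' : ℝ, 0 < δ' ∧ FourPoint X δ' :=
    ⟨max (3 * δ + 2) 1, by positivity, hX.fourPoint.mono (le_max_left _ _)⟩
  clear hX
  clear δ
  rename' δ' => δ
  obtain ⟨t₀, ht₀⟩ := hx₀
  have hf : ∀ m n : ℤ, dist (f ^ m • x₀) (f ^ n • x₀) = |(m : ℝ) - n| := fun m n => by
    rw [← ht₀, zpow_smul_axis haxis, zpow_smul_axis haxis, hgeo]
    congr 1; ring
  clear ht₀ hgeo haxis
  set o := x₀ with ho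
  obtain ⟨C, hC, hmark⟩ := exists_markers h4 hδ hiso hf hwpd hnvc
  have hSfin := finite_setOf_wordNorm_le_one hgen
  obtain ⟨K, hK0, hK⟩ : ∃ K : ℝ, 0 ≤ K ∧ ∀ s : G, wordNorm S s ≤ 1 → dist o (s • o) ≤ K := by
    obtain ⟨K, hK⟩ := (hSfin.image fun s => dist o (s • o)).bddAbove
    exact ⟨max K 0, le_max_right _ _,
      fun s hs => (hK ⟨s, hs, rfl⟩).trans (le_max_left _ _)⟩
  obtain ⟨C', hC'⟩ : ∃ C', C' = C + 2 * δ + K := ⟨_, rfl⟩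
  obtain ⟨D, hD⟩ : ∃ D, D = 2 * C' + 4 * δ + 1 := ⟨_, rfl⟩
  obtain ⟨N₀, hN₀⟩ := hmark (D + K + 6 * C + 6 * δ) (by linarith)
  obtain ⟨N, hNN₀, hN⟩ : ∃ N ≥ N₀, 3 * C + 4 * δ < N := by
    obtain ⟨N, hN⟩ := exists_nat_gt (3 * C + 4 * δ)
    exact ⟨max N₀ N, le_max_left _ _, hN.trans_le (by exact_mod_cast le_max_right _ _)⟩
  obtain ⟨F, hFfin, hFlen, hFsel, hΨ⟩ := hN₀ N hNN₀
  set Ψ₀ : Set G := {γ : G | dist o (γ • o) ≤ D + K + 6 * C + 6 * δ ∧ ∃ h ∈ F, ∃ h' ∈ F,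
    dist (h • o) (γ • h' • o) ≤ D + K + 6 * C + 6 * δ} with hΨ₀
  set Ψ : Set G := (Ψ₀ ∪ Ψ₀⁻¹) ∪ {1} with hΨdef
  have hΨfin : Ψ.Finite := (hΨ.union hΨ.inv).union (Set.finite_singleton 1)
  have hΨinv : ∀ γ ∈ Ψ, γ⁻¹ ∈ Ψ := by
    rintro γ ((h | h) | h)
    · exact Or.inl (Or.inr (by simpa using h))
    · exact Or.inl (Or.inl h)
    · exact Or.inr (by rw [Set.mem_singleton_iff] at h ⊢; simp [h])
  obtain ⟨M, hM⟩ : ∃ M : ℕ, ∀ γ ∈ Ψ, ∀ h ∈ F, wordNorm S (γ * h) ≤ M := by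
    obtain ⟨M, hM⟩ := ((hΨfin.image2 (· * ·) hFfin).image (wordNorm S)).bddAbove
    exact ⟨M, fun γ hγ h hh => hM ⟨_, ⟨γ, hγ, h, hh, rfl⟩, rfl⟩⟩
  have hM0 : (0 : ℝ) ≤ M := Nat.cast_nonneg M
  obtain ⟨r, hr⟩ : ∃ r, r = (C' + 2 * δ + K) + 2 * C + 3 * δ + 1 + M := ⟨_, rfl⟩
  have hr0 : 0 < r := by linarith
  refine ⟨r, hr0, fun R hR y => ?_⟩
  set H : ℕ → Set G := fun i => {v | ∃ a : X, i * r ≤ gromovProd o a y ∧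
    Relation.ReflTransGen (Beyond o C' D) a (v • o)} with hH
  set B : ℕ → Set G := fun i => {v | v ∉ H i ∧ ∃ s, wordNorm S s ≤ 1 ∧ v * s ∈ H i} with hB
  have hHle : ∀ i, ∀ v ∈ H i, i * r - (C' + 2 * δ) ≤ gromovProd o (v • o) y := by
    rintro i v ⟨a, ha, hav⟩
    rcases h4.eq_or_gromovProd_le_of_reflTransGen hδ (by linarith) hav with rfl | h
    · linarith
    · linarith [h4.le_gromovProd_of_gromovProd_le (by linarith) h ha]
  have hstep : ∀ v s : G, wordNorm S s ≤ 1 → dist (v • o) ((v * s) • o) ≤ K := by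
    intro v s hs
    rw [mul_smul, hiso]; exact hK s hs
  have hBlow : ∀ i, ∀ v ∈ B i, i * r - (C' + 2 * δ + K) ≤ gromovProd o (v • o) y := by
    rintro i v ⟨-, s, hs, hvs⟩
    have h1 := hHle i _ hvs
    have h2 := gromovProd_le_add_dist o y ((v * s) • o) (v • o)
    rw [gromovProd_comm o y, gromovProd_comm o y, dist_comm] at h2
    linarith [hstep v s hs]
  have hBup : ∀ i, ∀ v ∈ B i, gromovProd o (v • o) y < i * r := by
    rintro i v ⟨hv, -⟩
    by_contra! hcon
    exact hv ⟨_, hcon, Relation.ReflTransGen.refl⟩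
  have hspaced : ∀ i j, ∀ v ∈ B i, ∀ v' ∈ B j,
      |gromovProd o (v' • o) y - gromovProd o (v • o) y| ≤ C + 3 * δ → i = j := by
    intro i j v hv v' hv' hle
    rw [abs_le] at hle
    have a1 := hBlow i v hv
    have a2 := hBup i v hv
    have a3 := hBlow j v' hv'
    have a4 := hBup j v' hv'
    rcases lt_trichotomy i j with h | h | h
    · have h' : (i : ℝ) + 1 ≤ j := by exact_mod_cast h
      nlinarith [mul_le_mul_of_nonneg_right h' hr0.le]
    · exact h
    · have h' : (j : ℝ) + 1 ≤ i := by exact_mod_cast h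
      nlinarith [mul_le_mul_of_nonneg_right h' hr0.le]
  set U : Set G := ⋃ i ∈ Finset.Icc 1 ⌊R / r⌋₊, B i with hU
  have hUmem : ∀ v ∈ U, ∃ i, 1 ≤ i ∧ v ∈ B i := by
    intro v hv
    simp only [hU, Set.mem_iUnion, Finset.mem_Icc] at hv
    obtain ⟨i, hi, hv⟩ := hv
    exact ⟨i, hi.1, hv⟩
  have hUlow : ∀ v ∈ U, r - (C' + 2 * δ + K) ≤ gromovProd o (v • o) y := by
    intro v hv
    obtain ⟨i, hi, hv⟩ := hUmem v hv
    have h' : (1 : ℝ) ≤ i := by exact_mod_cast hi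
    nlinarith [hBlow i v hv, mul_le_mul_of_nonneg_right h' hr0.le]
  have hmarker : ∀ v : G, ∃ h ∈ F, gromovProd (v • o) o ((v * h) • o) ≤ C ∧
      gromovProd (v • o) y ((v * h) • o) ≤ C ∧ gromovProd o y (h⁻¹ • o) ≤ C := by
    intro v
    obtain ⟨h, hh, h1, h2, h3⟩ := hFsel (v⁻¹ • o) (v⁻¹ • y) y
    refine ⟨h, hh, ?_, ?_, h3⟩
    · rw [← gromovProd_smul hiso v⁻¹, mul_smul, inv_smul_smul, inv_smul_smul]; exact h1
    · rw [← gromovProd_smul hiso v⁻¹, mul_smul, inv_smul_smul, inv_smul_smul]; exact h2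
  choose μ hμF hμo hμy hμinv using hmarker
  obtain ⟨A, hAU, hAsep, hAnet⟩ := exists_separated_net hΨinv (Or.inr rfl) U
  set B' : Set G := (fun v => v * μ v) '' A with hB'
  have hμlen : ∀ v : G, |dist (v • o) ((v * μ v) • o) - N| ≤ C := by
    intro v
    rw [mul_smul, hiso]; exact hFlen _ (hμF v)
  have hmid : ∀ v : G, ∀ q : G, (q = 1 ∨ C + δ < gromovProd o (q • o) y) →
      gromovProd ((v * μ v) • o) (v • o) ((v * μ v * q) • o) ≤ C + δ := by
    intro v q hq
    have h1 : gromovProd o ((μ v)⁻¹ • o) (q • o) ≤ C + δ := by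
      rcases hq with rfl | hq
      · rw [one_smul]; unfold gromovProd; rw [dist_self, dist_comm]; linarith
      · have := hμinv v
        rw [gromovProd_comm] at this hq
        exact h4.gromovProd_le this hq
    rw [← gromovProd_smul hiso (v * μ v), smul_smul, smul_smul] at h1
    simpa using h1
  have hlocal : ∀ v : G, ∀ q : G, (q = 1 ∨ C + δ < gromovProd o (q • o) y) →
      gromovProd (v • o) o ((v * μ v * q) • o) ≤ C + δ ∧
      gromovProd ((v * μ v) • o) o ((v * μ v * q) • o) ≤ C + 2 * δ := by
    intro v q hq
    exact h4.gromovProd_le_of_local (by linarith [(abs_le.1 (hμlen v)).1]) (hμo v) (hmid v q hq)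
  have hword : ∀ l : List G, (∀ x ∈ l, x ∈ B') →
      l.prod = 1 ∨ C + δ < gromovProd o (l.prod • o) y := by
    intro l
    induction l with
    | nil => intro _; left; rfl
    | cons b l ih =>
      intro hl
      simp only [List.mem_cons, forall_eq_or_imp] at hl
      obtain ⟨⟨v, hv, rfl⟩, hl⟩ := hl
      right
      have h1 := (hlocal v _ (ih hl)).1
      have h2 := h4.le_gromovProd_of_gromovProd_le (by linarith) h1 (hUlow v (hAU hv))
      rw [List.prod_cons]
      linarith
  have hdecode : ∀ v ∈ A, ∀ v' ∈ A, ∀ q q' : G, (q = 1 ∨ C + δ < gromovProd o (q • o) y) →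
      (q' = 1 ∨ C + δ < gromovProd o (q' • o) y) → v * μ v * q = v' * μ v' * q' →
      dist o (v • o) ≤ dist o (v' • o) → v = v' := by
    intro v hv v' hv' q q' hq hq' he hle
    obtain ⟨h1, h2⟩ := hlocal v q hq
    obtain ⟨h1', h2'⟩ := hlocal v' q' hq'
    have h3 := hmid v q hq
    rw [← he] at h1' h2'
    have hlen := abs_le.1 (hμlen v)
    have hlen' := abs_le.1 (hμlen v')
    by_cases hfar : dist o (v • o) + (D + K) ≤ dist o (v' • o)
    · exfalso
      obtain ⟨h5, h6⟩ := h4.abs_gromovProd_sub_le hδ hC h1 h1' (by linarith) hfar h3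
        (by linarith) (hμy v)
      obtain ⟨i, -, hvi⟩ := hUmem v (hAU hv)
      obtain ⟨j, -, hvj⟩ := hUmem v' (hAU hv')
      obtain rfl := hspaced i j v hvi v' hvj h6
      obtain ⟨-, s, hs, a, ha, hav⟩ := hvi
      refine hvj.1 ⟨a, ha, hav.tail ⟨?_, ?_⟩⟩
      · linarith [gromovProd_le_add_dist_base ((v * s) • o) (v • o) o (v' • o), hstep v s hs,
          dist_comm ((v * s) • o) (v • o)]
      · linarith [hstep v s hs, dist_triangle o (v • o) ((v * s) • o)]
    · have h5 := h4.dist_le_of_gromovProd_le h1 h1'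
      have h6 := h4.dist_le_of_gromovProd_le h2 h2'
      rw [abs_of_nonpos (by linarith)] at h5
      have hoa := hμo v
      have hoa' := hμo v'
      have h7 : |dist o ((v * μ v) • o) - dist o ((v' * μ v') • o)| ≤ D + K + 4 * C := by
        have t1 := dist_triangle o (v • o) ((v * μ v) • o)
        have t2 := dist_triangle o (v' • o) ((v' * μ v') • o)
        unfold gromovProd at hoa hoa'
        rw [dist_comm (v • o) o] at hoa
        rw [dist_comm (v' • o) o] at hoa'
        rw [abs_le]
        constructor <;> linarith
      refine hAsep v hv v' hv' (Or.inl (Or.inl ⟨?_, μ v, hμF v, μ v', hμF v', ?_⟩))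
      · rw [← hiso v, smul_smul, mul_inv_cancel_left]
        linarith
      · rw [← hiso v, smul_smul, smul_smul, smul_smul, ← mul_assoc, mul_inv_cancel, one_mul]
        linarith
  refine ⟨B, ?_, ⟨B', ?_, ?_⟩, ?_⟩
  · intro i _ j _ hij
    rw [Set.disjoint_left]
    intro v hvi hvj
    exact hij (hspaced i j v hvi v hvj (by rw [sub_self, abs_zero]; linarith))
  · intro b hb
    obtain ⟨a, ha, hba⟩ := hAnet b hb
    refine ⟨a * μ a, ⟨a, ha, rfl⟩, ?_⟩
    have h1 : (wordDist S b (a * μ a) : ℝ) ≤ M := by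
      rw [wordDist, ← mul_assoc]
      exact_mod_cast hM _ hba _ (hμF a)
    linarith
  · intro k _ g h hg hh he
    refine List.ofFn_injective (list_eq_of_prod_eq (B := B') ?_ _ _ (by simp) ?_ ?_ he)
    · rintro _ ⟨v, hv, rfl⟩ _ ⟨v', hv', rfl⟩ l l' hl hl' he
      have : v = v' := by
        rcases le_total (dist o (v • o)) (dist o (v' • o)) with hle | hle
        · exact hdecode v hv v' hv' _ _ (hword l hl) (hword l' hl') he hle
        · exact (hdecode v' hv' v hv _ _ (hword l' hl') (hword l hl) he.symm hle).symm
      rw [this]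
    · intro x hx
      obtain ⟨i, rfl⟩ := (List.mem_ofFn' _ _).1 hx
      exact hg i
    · intro x hx
      obtain ⟨i, rfl⟩ := (List.mem_ofFn' _ _).1 hx
      exact hh i
  · intro i hi g hg n γ h0 hn hγ
    rw [Finset.mem_Icc] at hi
    have hiR : i * r ≤ R := by
      have h1 : (i : ℝ) ≤ ⌊R / r⌋₊ := by exact_mod_cast hi.2
      have h2 := Nat.floor_le (div_nonneg hR.le hr0.le)
      exact (le_div_iff₀ hr0).1 (h1.trans h2)
    have hend : γ n ∈ H i := by
      rw [hn]; exact ⟨_, hiR.trans hg.le, Relation.ReflTransGen.refl⟩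
    have hstart : γ 0 ∉ H i := by
      intro hcon
      have h1 := hHle i _ hcon
      rw [h0, one_smul] at h1
      have h2 : (1 : ℝ) ≤ i := by exact_mod_cast hi.1
      have h3 := gromovProd_le_dist o o y
      rw [dist_self] at h3
      nlinarith [mul_le_mul_of_nonneg_right h2 hr0.le]
    have hcross : ∀ m ≤ n, γ m ∈ H i → ∃ t ≤ n, γ t ∈ B i := by
      intro m
      induction m with
      | zero => intro _ h; exact (hstart h).elim
      | succ m ih =>
        intro hm h
        by_cases hmem : γ m ∈ H i
        · exact ih (by omega) hmem
        · exact ⟨m, by omega, hmem, (γ m)⁻¹ * γ (m + 1), hγ m (by omega), by simpa using h⟩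
    exact hcross n le_rfl hend
end
end

section
/- Let X be a geodesic δ-hyperbolic metric space, let G be a group that is not virtually cyclic acting on X by isometries with a unital axial WPD loxodromic element f ∈ G, let x₀ ∈ Ax(f), and let S be a finite generating set of G. Then for each D > 0 there exists r > 0 such that the set 𝒩𝓕_D := {g ∈ G : d_γ(x₀, gx₀) < D for every γ ∈ 𝒜}, where 𝒜 := {g·Ax(f) : g ∈ G}, is r-roughly branching. -/
noncomputable section

open Set Metric Pointwise

namespace GromovHyperbolic

variable {X : Type*} [MetricSpace X]

theorem mono {δ δ' : ℝ} (h : δ ≤ δ') (hX : GromovHyperbolic X δ) : GromovHyperbolic X δ' := by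
  refine ⟨hX.1, fun x y z γ₁ γ₂ γ₃ h₁ h₂ h₃ t ht => ?_⟩
  obtain ⟨u, hu, hd⟩ := hX.2 x y z γ₁ γ₂ γ₃ h₁ h₂ h₃ t ht
  exact ⟨u, hu, hd.trans h⟩

theorem dist_add_dist_of_mem_geodesic {γ : ℝ → X} {x y u : X} (hγ : IsGeodesicBetween γ x y)
    (hu : u ∈ γ '' Icc (0 : ℝ) (dist x y)) : dist x u + dist u y = dist x y := by
  obtain ⟨t, ht, rfl⟩ := hu
  have h0 := hγ.2.2 0 (left_mem_Icc.2 dist_nonneg) t ht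
  have h1 := hγ.2.2 t ht _ (right_mem_Icc.2 dist_nonneg)
  rw [hγ.1, zero_sub, abs_neg, abs_of_nonneg ht.1] at h0
  rw [hγ.2.1, abs_of_nonpos (by linarith [ht.2])] at h1
  linarith

theorem dist_add_dist_le_of_dist_le {γ : ℝ → X} {x y u m : X} {e : ℝ}
    (hγ : IsGeodesicBetween γ x y) (hu : u ∈ γ '' Icc (0 : ℝ) (dist x y)) (hm : dist m u ≤ e) :
    dist x m + dist m y ≤ dist x y + 2 * e := by
  have h := dist_add_dist_of_mem_geodesic hγ hu
  have h1 := dist_triangle x u m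
  have h2 := dist_triangle m u y
  rw [dist_comm u m] at h1
  linarith

/-- A side of a thin triangle contains a point close to both of the other sides. -/
theorem exists_center {δ : ℝ} (hδ : 0 < δ) (hX : GromovHyperbolic X δ) {x y w : X} {γ : ℝ → X}
    (hγ : IsGeodesicBetween γ x w) :
    ∃ t ∈ Icc (0 : ℝ) (dist x w), dist x (γ t) + dist (γ t) y ≤ dist x y + 4 * δ ∧
      dist y (γ t) + dist (γ t) w ≤ dist y w + 4 * δ := by
  obtain ⟨γ₂, h₂⟩ := hX.1 x y
  obtain ⟨γ₃, h₃⟩ := hX.1 y w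
  let T : Set ℝ := {t | t ∈ Icc (0 : ℝ) (dist x w) ∧
    ∃ u ∈ γ₂ '' Icc (0 : ℝ) (dist x y), dist (γ t) u ≤ δ}
  have hT0 : (0 : ℝ) ∈ T := by
    refine ⟨left_mem_Icc.2 dist_nonneg, γ₂ 0, ⟨0, left_mem_Icc.2 dist_nonneg, rfl⟩, ?_⟩
    rw [hγ.1, h₂.1, dist_self]
    exact hδ.le
  have hTb : BddAbove T := ⟨dist x w, fun t ht => ht.1.2⟩
  obtain ⟨t, htT, ht⟩ := exists_lt_of_lt_csSup ⟨0, hT0⟩ (show sSup T - δ / 2 < sSup T by linarith)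
  obtain ⟨htI, u, hu, htu⟩ := htT
  have hts : t ≤ sSup T := le_csSup hTb ⟨htI, u, hu, htu⟩
  have hfar : ∃ t' ∈ Icc (0 : ℝ) (dist x w), |t - t'| ≤ δ ∧
      ∃ v ∈ γ₃ '' Icc (0 : ℝ) (dist y w), dist (γ t') v ≤ δ := by
    rcases le_or_gt (sSup T + δ / 2) (dist x w) with h | h
    · have hI : sSup T + δ / 2 ∈ Icc (0 : ℝ) (dist x w) := ⟨by linarith [htI.1], h⟩
      refine ⟨sSup T + δ / 2, hI, by rw [abs_le]; constructor <;> linarith, ?_⟩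
      obtain ⟨v, hv | hv, hd⟩ := hX.2 x y w γ γ₂ γ₃ hγ h₂ h₃ _ hI
      · have := le_csSup hTb (show sSup T + δ / 2 ∈ T from ⟨hI, v, hv, hd⟩)
        linarith
      · exact ⟨v, hv, hd⟩
    · refine ⟨dist x w, right_mem_Icc.2 dist_nonneg,
        by rw [abs_le]; constructor <;> linarith [htI.2],
        γ₃ (dist y w), ⟨_, right_mem_Icc.2 dist_nonneg, rfl⟩, ?_⟩
      rw [hγ.2.1, h₃.2.1, dist_self]
      exact hδ.le
  obtain ⟨t', ht'I, htt', v, hv, hd⟩ := hfar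
  refine ⟨t, htI, ?_, ?_⟩
  · linarith [dist_add_dist_le_of_dist_le h₂ hu htu]
  · have h1 : dist (γ t) v ≤ 2 * δ := by
      have h2 := dist_triangle (γ t) (γ t') v
      rw [hγ.2.2 t htI t' ht'I] at h2
      linarith
    linarith [dist_add_dist_le_of_dist_le h₃ hv h1]

theorem four_point {δ : ℝ} (hδ : 0 < δ) (hX : GromovHyperbolic X δ) (x y z w : X) :
    dist x w + dist y z ≤ max (dist x y + dist z w) (dist x z + dist y w) + 6 * δ := by
  obtain ⟨γ, hγ⟩ := hX.1 x w
  obtain ⟨γ₂, h₂⟩ := hX.1 x z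
  obtain ⟨γ₃, h₃⟩ := hX.1 z w
  obtain ⟨t, htI, hxy, hyw⟩ := exists_center hδ hX (y := y) hγ
  have hm := dist_add_dist_of_mem_geodesic hγ ⟨t, htI, rfl⟩
  have htri := dist_triangle y (γ t) z
  have hxy' := dist_comm y (γ t)
  have hz' := dist_comm z (γ t)
  obtain ⟨u, hu | hu, hd⟩ := hX.2 x z w γ γ₂ γ₃ hγ h₂ h₃ t htI
  · have h := dist_add_dist_le_of_dist_le h₂ hu hd
    have := le_max_right (dist x y + dist z w) (dist x z + dist y w)
    linarith
  · have h := dist_add_dist_le_of_dist_le h₃ hu hd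
    have := le_max_left (dist x y + dist z w) (dist x z + dist y w)
    linarith

theorem dist_add_le_of_nearest {δ : ℝ} (hδ : 0 < δ) (hX : GromovHyperbolic X δ) {x : X}
    {γ : ℝ → X} (hγ : ∀ s t : ℝ, dist (γ s) (γ t) = |s - t|)
    (hmin : ∀ s, dist x (γ 0) ≤ dist x (γ s)) {t : ℝ} (ht : 0 ≤ t) :
    dist x (γ 0) + t ≤ dist x (γ t) + 6 * δ := by
  rcases le_or_gt t (3 * δ) with h | h
  · linarith [hmin t]
  have hdt : dist (γ 0) (γ t) = t := by rw [hγ, zero_sub, abs_neg, abs_of_nonneg ht]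
  obtain ⟨γ₂, h₂⟩ := hX.1 (γ 0) x
  obtain ⟨γ₃, h₃⟩ := hX.1 x (γ t)
  have hds : dist (γ 0) (γ (3 * δ)) = 3 * δ := by
    rw [hγ, zero_sub, abs_neg, abs_of_pos (by linarith)]
  have hst : dist (γ (3 * δ)) (γ t) = t - 3 * δ := by
    rw [hγ, abs_of_neg (by linarith)]; ring
  obtain ⟨u, hu | hu, hd⟩ := hX.2 (γ 0) x (γ t) γ γ₂ γ₃
    ⟨rfl, by rw [hdt], fun s _ s' _ => hγ s s'⟩ h₂ h₃ (3 * δ) ⟨by linarith, by linarith⟩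
  · have h1 := dist_add_dist_of_mem_geodesic h₂ hu
    have h2 := dist_triangle x u (γ (3 * δ))
    have h3 := dist_triangle (γ 0) u (γ (3 * δ))
    rw [dist_comm u (γ (3 * δ)), dist_comm x u] at h2
    rw [dist_comm u (γ (3 * δ))] at h3
    have h4 := hmin (3 * δ)
    rw [dist_comm (γ 0) x] at h1
    linarith
  · have h1 := dist_add_dist_le_of_dist_le h₃ hu hd
    linarith [hmin (3 * δ)]

theorem dist_add_abs_le_of_nearest {δ : ℝ} (hδ : 0 < δ) (hX : GromovHyperbolic X δ) {x : X}
    {ℓ : ℝ → X} (hℓ : ∀ s t : ℝ, dist (ℓ s) (ℓ t) = |s - t|) {p : ℝ}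
    (hmin : ∀ s, dist x (ℓ p) ≤ dist x (ℓ s)) (t : ℝ) :
    dist x (ℓ p) + |t - p| ≤ dist x (ℓ t) + 6 * δ := by
  rcases le_total p t with h | h
  · have := dist_add_le_of_nearest hδ hX (x := x) (γ := fun s => ℓ (p + s)) (t := t - p)
      (fun s t => by rw [hℓ]; congr 1; ring) (fun s => by simpa using hmin _) (by linarith)
    rw [abs_of_nonneg (by linarith)]
    simpa using this
  · have := dist_add_le_of_nearest hδ hX (x := x) (γ := fun s => ℓ (p - s)) (t := p - t)
      (fun s t => by rw [hℓ, abs_sub_comm]; congr 1; ring) (fun s => by simpa using hmin _)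
      (by linarith)
    rw [abs_of_nonpos (by linarith)]
    simpa using this

end GromovHyperbolic

theorem exists_nearest_on_line {X : Type*} [MetricSpace X] {ℓ : ℝ → X}
    (hℓ : ∀ s t : ℝ, dist (ℓ s) (ℓ t) = |s - t|) (x : X) :
    ∃ p, ∀ s, dist x (ℓ p) ≤ dist x (ℓ s) := by
  have hcont : Continuous ℓ :=
    (Isometry.of_dist_eq fun s t => by rw [hℓ, Real.dist_eq]).continuous
  have h0 : (0 : ℝ) ∈ Icc (-(2 * dist x (ℓ 0))) (2 * dist x (ℓ 0)) := by
    constructor <;> linarith [dist_nonneg (x := x) (y := ℓ 0)]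
  obtain ⟨p, -, hp⟩ := isCompact_Icc.exists_isMinOn ⟨0, h0⟩
    (continuous_const.dist hcont : Continuous fun t => dist x (ℓ t)).continuousOn
  refine ⟨p, fun s => ?_⟩
  by_cases hs : s ∈ Icc (-(2 * dist x (ℓ 0))) (2 * dist x (ℓ 0))
  · exact hp hs
  · have h1 : dist x (ℓ p) ≤ dist x (ℓ 0) := hp h0
    have h2 := hℓ s 0
    rw [sub_zero] at h2
    have h3 := dist_triangle (ℓ s) x (ℓ 0)
    rw [dist_comm (ℓ s) x] at h3
    have h4 : 2 * dist x (ℓ 0) < |s| := by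
      by_contra! h
      exact hs (abs_le.1 h)
    linarith

/-- `π` is a coarse closest-point projection, in coordinates, to the line `ℓ` in a space
satisfying the four-point condition; both error terms are bounded by `c`. -/
structure CoarseProjection {X : Type*} [MetricSpace X] (ℓ : ℝ → X) (c : ℝ) (π : X → ℝ) :
    Prop where
  geodesic : ∀ s t : ℝ, dist (ℓ s) (ℓ t) = |s - t|
  pos : 0 < c
  four_point : ∀ x y z w : X,
    dist x w + dist y z ≤ max (dist x y + dist z w) (dist x z + dist y w) + c
  proj : ∀ x t, dist x (ℓ (π x)) + |t - π x| ≤ dist x (ℓ t) + c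

namespace CoarseProjection

theorem pow_smul_line {X G : Type*} [Group G] [MulAction G X] {ℓ : ℝ → X} {f : G}
    (haxis : ∀ t : ℝ, f • ℓ t = ℓ (t + 1)) (n : ℕ) (t : ℝ) :
    f ^ n • ℓ t = ℓ (t + n) := by
  induction n with
  | zero => simp
  | succ n ih => rw [pow_succ', mul_smul, ih, haxis]; push_cast; ring_nf

section Metric

variable {X : Type*} [MetricSpace X] {ℓ : ℝ → X} {c : ℝ} {π : X → ℝ}

theorem abs_proj_line_sub_le (h : CoarseProjection ℓ c π) (t : ℝ) : |t - π (ℓ t)| ≤ c := by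
  have := h.proj (ℓ t) t
  rw [dist_self] at this
  linarith [dist_nonneg (x := ℓ t) (y := ℓ (π (ℓ t)))]

/-- Geodesics between points with distant projections pass close to these projections. -/
theorem dist_ge_of_lt_abs_sub (h : CoarseProjection ℓ c π) {x y : X}
    (hxy : 2 * c < |π x - π y|) :
    dist x (ℓ (π x)) + |π x - π y| + dist y (ℓ (π y)) ≤ dist x y + 3 * c := by
  have h4 := h.four_point x (ℓ (π x)) y (ℓ (π y))
  have h1 := h.proj x (π y)
  have h2 := h.proj y (π x)
  rw [abs_sub_comm] at h1
  rw [h.geodesic, dist_comm (ℓ (π x)) y] at h4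
  rcases le_max_iff.1 (sub_le_iff_le_add.2 h4) with h5 | h5 <;> linarith [h.pos]

end Metric

variable {X : Type*} [MetricSpace X] {G : Type*} [Group G] [MulAction G X]
  {ℓ : ℝ → X} {c : ℝ} {π : X → ℝ} {f : G}

theorem dist_inv_smul (hiso : ∀ (g : G) (x y : X), dist (g • x) (g • y) = dist x y)
    (g : G) (x y : X) : dist (g⁻¹ • x) y = dist x (g • y) := by
  rw [← hiso g, smul_inv_smul]

theorem abs_proj_pow_smul_sub_le (h : CoarseProjection ℓ c π)
    (hiso : ∀ (g : G) (x y : X), dist (g • x) (g • y) = dist x y)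
    (haxis : ∀ t : ℝ, f • ℓ t = ℓ (t + 1)) (n : ℕ) (x : X) :
    |π x + n - π (f ^ n • x)| ≤ c := by
  have h1 := h.proj (f ^ n • x) (π x + n)
  have h2 := h.proj x (π (f ^ n • x) - n)
  have e1 : dist (f ^ n • x) (ℓ (π x + n)) = dist x (ℓ (π x)) := by
    rw [← pow_smul_line haxis, hiso]
  have e2 : dist x (ℓ (π (f ^ n • x) - n)) = dist (f ^ n • x) (ℓ (π (f ^ n • x))) := by
    rw [← hiso (f ^ n), pow_smul_line haxis, sub_add_cancel]
  have e3 : |π (f ^ n • x) - n - π x| = |π x + n - π (f ^ n • x)| := by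
    rw [abs_sub_comm]; congr 1; ring
  rw [e1] at h1
  rw [e2, e3] at h2
  linarith

/-- Behrstock's inequality for two translates of `ℓ` with bounded mutual projections. -/
theorem behrstock (h : CoarseProjection ℓ c π)
    (hiso : ∀ (g : G) (x y : X), dist (g • x) (g • y) = dist x y) {K : ℝ} {g k : G}
    (hgk : ∀ t, |π ((g⁻¹ * k) • ℓ t)| ≤ K) (hkg : ∀ t, |π ((k⁻¹ * g) • ℓ t)| ≤ K) (z : X) :
    |π (g⁻¹ • z)| ≤ K + 3 * c ∨ |π (k⁻¹ • z)| ≤ K + 3 * c := by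
  have key : ∀ g k : G, (∀ t, |π ((g⁻¹ * k) • ℓ t)| ≤ K) → K + 3 * c < |π (g⁻¹ • z)| →
      dist (g⁻¹ • z) (ℓ (π (g⁻¹ • z))) < dist (k⁻¹ • z) (ℓ (π (k⁻¹ • z))) := by
    intro g k hgk hg
    set b := π (k⁻¹ • z)
    have h1 : |π (g⁻¹ • z)| - |π ((g⁻¹ * k) • ℓ b)| ≤ |π (g⁻¹ • z) - π ((g⁻¹ * k) • ℓ b)| :=
      abs_sub_abs_le_abs_sub _ _
    have h2 := h.dist_ge_of_lt_abs_sub (x := g⁻¹ • z) (y := (g⁻¹ * k) • ℓ b)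
      (by linarith [hgk b, h.pos])
    have h3 : dist (g⁻¹ • z) ((g⁻¹ * k) • ℓ b) = dist (k⁻¹ • z) (ℓ b) := by
      rw [mul_smul, hiso, dist_inv_smul hiso]
    rw [h3] at h2
    linarith [hgk b, dist_nonneg (x := (g⁻¹ * k) • ℓ b) (y := ℓ (π ((g⁻¹ * k) • ℓ b)))]
  by_contra! hcon
  exact lt_asymm (key g k hgk hcon.1) (key k g hkg hcon.2)

/-- Elements almost fixing `x₀ = ℓ 0` and almost sending one point of the `f`-orbit at distance
`L` from `x₀` to another one form a finite set. -/
theorem finite_of_wpd (hiso : ∀ (g : G) (x y : X), dist (g • x) (g • y) = dist x y)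
    (haxis : ∀ t : ℝ, f • ℓ t = ℓ (t + 1)) {E R : ℝ} (hER : 2 * E < R) {L : ℕ}
    (hfin : {g : G | dist (ℓ 0) (g • ℓ 0) < R ∧
      dist ((f ^ L) • ℓ 0) ((g * f ^ L) • ℓ 0) < R}.Finite)
    {τ : ℝ} (hτ : τ = L ∨ τ = -L) (q : X) :
    {u : G | dist (ℓ 0) (u • ℓ 0) ≤ E ∧ dist q (u • ℓ τ) ≤ E}.Finite := by
  set V := {u : G | dist (ℓ 0) (u • ℓ 0) ≤ E ∧ dist q (u • ℓ τ) ≤ E}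
  rcases V.eq_empty_or_nonempty with hV | ⟨v, hv⟩
  · rw [hV]; exact finite_empty
  have key : ∀ u ∈ V, dist (ℓ 0) ((v⁻¹ * u) • ℓ 0) < R ∧ dist (ℓ τ) ((v⁻¹ * u) • ℓ τ) < R := by
    intro u hu
    constructor
    · rw [mul_smul, dist_comm, dist_inv_smul hiso]
      linarith [dist_triangle_left (u • ℓ 0) (v • ℓ 0) (ℓ 0), hu.1, hv.1]
    · rw [mul_smul, dist_comm, dist_inv_smul hiso]
      linarith [dist_triangle_left (u • ℓ τ) (v • ℓ τ) q, hu.2, hv.2]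
  rcases hτ with rfl | rfl
  · refine (hfin.image fun w => v * w).subset fun u hu => ⟨v⁻¹ * u, ?_, by simp⟩
    refine ⟨(key u hu).1, ?_⟩
    rw [mul_smul _ (f ^ L), pow_smul_line haxis, zero_add]
    exact (key u hu).2
  · refine (hfin.image fun w => v * ((f ^ L)⁻¹ * w * f ^ L)).subset fun u hu =>
      ⟨f ^ L * (v⁻¹ * u) * (f ^ L)⁻¹, ⟨?_, ?_⟩, by group⟩
    · have h0 : ℓ 0 = f ^ L • ℓ (-L) := by rw [pow_smul_line haxis, neg_add_cancel]
      have h1 : (f ^ L)⁻¹ • ℓ 0 = ℓ (-L) := by rw [h0, inv_smul_smul]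
      rw [mul_smul, mul_smul, h1]
      conv_lhs => rw [h0]
      rw [hiso]
      exact (key u hu).2
    · rw [inv_mul_cancel_right, mul_smul _ _ (ℓ 0), hiso]
      exact (key u hu).1

theorem exists_eq_or_eq_neg_abs_sub_eq {a L : ℝ} (hL : 0 ≤ L) (ha : L ≤ |a|) :
    ∃ σ, (σ = L ∨ σ = -L) ∧ |σ| = L ∧ |a - σ| = |a| - L := by
  rcases le_total 0 a with h | h
  · rw [abs_of_nonneg h] at ha ⊢
    exact ⟨L, .inl rfl, abs_of_nonneg hL, abs_of_nonneg (by linarith)⟩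
  · rw [abs_of_nonpos h] at ha ⊢
    refine ⟨-L, .inr rfl, by rw [abs_neg, abs_of_nonneg hL], ?_⟩
    rw [abs_of_nonpos (by linarith)]; ring

/-- If `ℓ` and `u • ℓ` fellow-travel for long, and each of the basepoints `ℓ 0`, `u • ℓ 0` is
close to the projection of the other one, then `u` almost fixes `ℓ 0`. -/
theorem dist_smul_base_le (h : CoarseProjection ℓ c π)
    (hiso : ∀ (g : G) (x y : X), dist (g • x) (g • y) = dist x y) {E : ℝ} {u : G}
    (hu : |π (u • ℓ 0)| ≤ E) (hu' : |π (u⁻¹ • ℓ 0)| ≤ E) {t : ℝ}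
    (ht : E + 2 * c < |π (u • ℓ t)|) :
    dist (ℓ 0) (u • ℓ 0) ≤ 3 * E + 4 * c ∧
      dist (u • ℓ t) (ℓ (π (u • ℓ t))) + |π (u • ℓ t)| ≤ |t| + E + 3 * c := by
  set a := π (u • ℓ t)
  set e := π (u • ℓ 0)
  set e' := π (u⁻¹ • ℓ 0)
  have h1 : |a| - |e| ≤ |a - e| := abs_sub_abs_le_abs_sub _ _
  have h2 := h.dist_ge_of_lt_abs_sub (x := u • ℓ t) (y := u • ℓ 0) (by linarith)
  rw [hiso, h.geodesic, sub_zero] at h2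
  have h3 : dist (u⁻¹ • ℓ 0) (ℓ e') + |t - e'| ≤ dist (u⁻¹ • ℓ 0) (ℓ t) + c := h.proj _ t
  rw [dist_inv_smul hiso, dist_inv_smul hiso] at h3
  have h4 : |t| - |e'| ≤ |t - e'| := abs_sub_abs_le_abs_sub _ _
  have h5 : dist (ℓ 0) (u • ℓ t) ≤ |a| + dist (u • ℓ t) (ℓ a) := by
    have := dist_triangle (ℓ 0) (ℓ a) (u • ℓ t)
    rwa [h.geodesic, zero_sub, abs_neg, dist_comm (ℓ a)] at this
  have h6 : dist (ℓ 0) (u • ℓ 0) ≤ dist (ℓ 0) (u • ℓ e') + |e'| := by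
    have := dist_triangle (ℓ 0) (u • ℓ e') (u • ℓ 0)
    rwa [hiso, h.geodesic, sub_zero] at this
  have h7 : 0 ≤ dist (u • ℓ 0) (ℓ e) := dist_nonneg
  exact ⟨by linarith, by linarith⟩

/-- All but finitely many `u` for which the basepoints of `ℓ` and `u • ℓ` are close to the
projections of each other have bounded projection of `u • ℓ` to `ℓ`. -/
theorem exists_finite_forall_proj_le (h : CoarseProjection ℓ c π)
    (hiso : ∀ (g : G) (x y : X), dist (g • x) (g • y) = dist x y)
    (haxis : ∀ t : ℝ, f • ℓ t = ℓ (t + 1)) (hwpd : WPD f (ℓ 0)) {E : ℝ} (hE : 0 ≤ E) :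
    ∃ (F : Set G) (K : ℝ), F.Finite ∧ 0 ≤ K ∧ ∀ u : G, |π (u • ℓ 0)| ≤ E →
      |π (u⁻¹ • ℓ 0)| ≤ E → u ∉ F → ∀ t, |π (u • ℓ t)| ≤ K := by
  have hc := h.pos
  set E₁ := 7 * E + 12 * c with hE₁
  obtain ⟨L, -, hfin⟩ := hwpd (2 * E₁ + 1) (by positivity)
  have hV := fun (q : X) (τ : ℝ) (hτ : τ = L ∨ τ = -L) =>
    finite_of_wpd hiso haxis (E := E₁) (by linarith) hfin hτ q
  set V := fun (q : X) (τ : ℝ) => {u : G | dist (ℓ 0) (u • ℓ 0) ≤ E₁ ∧ dist q (u • ℓ τ) ≤ E₁}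
  have hVfin : (⋃ q ∈ ({(L : ℝ), -(L : ℝ)} : Set ℝ), ⋃ τ ∈ ({(L : ℝ), -(L : ℝ)} : Set ℝ),
      V (ℓ q) τ).Finite :=
    (toFinite _).biUnion fun q _ => (toFinite _).biUnion fun τ hτ => hV _ _ hτ
  refine ⟨_, L + E + 3 * c, hVfin, by positivity, fun u hu hu' huF t => ?_⟩
  by_contra! hcon
  have hL : (0 : ℝ) ≤ L := L.cast_nonneg
  obtain ⟨hbase, hlong⟩ := h.dist_smul_base_le hiso hu hu' (t := t) (by linarith)
  set y := u • ℓ t with hy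
  set a := π y
  have hya : 0 ≤ dist y (ℓ a) := dist_nonneg
  obtain ⟨σ, hσ, hσL, hσa⟩ := exists_eq_or_eq_neg_abs_sub_eq hL (a := a) (by linarith)
  obtain ⟨τ, hτ, hτL, hτt⟩ := exists_eq_or_eq_neg_abs_sub_eq hL (a := t) (by linarith)
  refine huF (mem_biUnion hσ (mem_biUnion hτ ⟨by linarith, ?_⟩))
  have h4 := h.four_point (ℓ σ) (ℓ 0) y (u • ℓ τ)
  have e1 : dist (ℓ σ) (ℓ 0) = L := by rw [h.geodesic, sub_zero, hσL]
  have e2 : dist y (u • ℓ τ) = |t| - L := by rw [hy, hiso, h.geodesic, hτt]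
  have e3 : dist (ℓ σ) y ≤ |a| - L + dist y (ℓ a) := by
    have := dist_triangle_right (ℓ σ) y (ℓ a)
    rwa [h.geodesic, abs_sub_comm, hσa] at this
  have e4 : dist (ℓ 0) (u • ℓ τ) ≤ dist (ℓ 0) (u • ℓ 0) + L := by
    have := dist_triangle (ℓ 0) (u • ℓ 0) (u • ℓ τ)
    rwa [hiso, h.geodesic, zero_sub, abs_neg, hτL] at this
  have e5 : |t| ≤ dist (ℓ 0) y + dist (ℓ 0) (u • ℓ 0) := by
    have := dist_triangle_left y (u • ℓ 0) (ℓ 0)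
    rwa [hy, hiso, h.geodesic, sub_zero] at this
  rw [e1, e2] at h4
  rcases le_max_iff.1 (sub_le_iff_le_add.2 h4) with h5 | h5 <;> linarith

/-- The projection of a product of elements `g * f ^ N` applied to the basepoint stays near the
basepoint, if no factor `g` moves `ℓ` to a line close to it. -/
theorem abs_proj_prod_le (h : CoarseProjection ℓ c π)
    (hiso : ∀ (g : G) (x y : X), dist (g • x) (g • y) = dist x y)
    (haxis : ∀ t : ℝ, f • ℓ t = ℓ (t + 1)) {A : Set G} {M : ℝ} (hM : c ≤ M)
    (hA : ∀ g ∈ A, ∀ z, |π z| ≤ M ∨ |π (g⁻¹ • z)| ≤ M) {N : ℕ} (hN : 2 * M + c < N)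
    (l : List G) (hl : ∀ b ∈ l, ∃ g ∈ A, g * f ^ N = b) : |π (l.prod • ℓ 0)| ≤ M := by
  induction l with
  | nil =>
    have := h.abs_proj_line_sub_le 0
    rw [zero_sub, abs_neg] at this
    simpa using this.trans hM
  | cons b l ih =>
    obtain ⟨g, hg, rfl⟩ := hl _ List.mem_cons_self
    refine (hA g hg _).resolve_right fun hcon => ?_
    have h1 := abs_le.1 (ih fun b hb => hl b (List.mem_cons_of_mem _ hb))
    have h2 := abs_le.1 (h.abs_proj_pow_smul_sub_le hiso haxis N (l.prod • ℓ 0))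
    rw [List.prod_cons, ← mul_smul, mul_assoc, inv_mul_cancel_left, mul_smul] at hcon
    linarith [(abs_le.1 hcon).2]

theorem prod_injective (h : CoarseProjection ℓ c π)
    (hiso : ∀ (g : G) (x y : X), dist (g • x) (g • y) = dist x y)
    (haxis : ∀ t : ℝ, f • ℓ t = ℓ (t + 1)) {A : Set G} {M : ℝ} (hM : c ≤ M)
    (hA : ∀ g ∈ A, ∀ z, |π z| ≤ M ∨ |π (g⁻¹ • z)| ≤ M)
    (hAA : A.Pairwise fun g k => ∀ z, |π (g⁻¹ • z)| ≤ M ∨ |π (k⁻¹ • z)| ≤ M)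
    {N : ℕ} (hN : 2 * M + c < N) (l l' : List G) (hlen : l.length = l'.length)
    (hl : ∀ b ∈ l, ∃ g ∈ A, g * f ^ N = b) (hl' : ∀ b ∈ l', ∃ g ∈ A, g * f ^ N = b)
    (hprod : l.prod = l'.prod) : l = l' := by
  induction l generalizing l' with
  | nil => exact (List.length_eq_zero_iff.1 hlen.symm).symm
  | cons b l ih =>
    cases l' with
    | nil => simp at hlen
    | cons b' l' =>
      have far : ∀ (g : G) (l : List G), (∀ b ∈ l, ∃ g ∈ A, g * f ^ N = b) →
          ¬ |π (g⁻¹ • ((g * f ^ N) :: l).prod • ℓ 0)| ≤ M := by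
        intro g l hl hcon
        have h1 := abs_le.1 (h.abs_proj_prod_le hiso haxis hM hA hN l hl)
        have h2 := abs_le.1 (h.abs_proj_pow_smul_sub_le hiso haxis N (l.prod • ℓ 0))
        rw [List.prod_cons, ← mul_smul, mul_assoc, inv_mul_cancel_left, mul_smul] at hcon
        linarith [(abs_le.1 hcon).2]
      obtain ⟨g, hg, rfl⟩ := hl _ List.mem_cons_self
      obtain ⟨g', hg', rfl⟩ := hl' _ List.mem_cons_self
      have hlt := fun b hb => hl b (List.mem_cons_of_mem _ hb)
      have hlt' := fun b hb => hl' b (List.mem_cons_of_mem _ hb)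
      by_cases hgg : g = g'
      · subst hgg
        rw [ih l' (by simpa using hlen) hlt hlt' (by simpa using hprod)]
      · rcases hAA hg hg' hgg (((g * f ^ N) :: l).prod • ℓ 0) with h1 | h1
        · exact absurd h1 (far g l hlt)
        · rw [hprod] at h1
          exact absurd h1 (far g' l' hlt')

end CoarseProjection

theorem GromovHyperbolic.exists_coarseProjection {X : Type*} [MetricSpace X] {δ : ℝ}
    (hX : GromovHyperbolic X δ) {ℓ : ℝ → X} (hℓ : ∀ s t : ℝ, dist (ℓ s) (ℓ t) = |s - t|) :
    ∃ (c : ℝ) (π : X → ℝ), CoarseProjection ℓ c π ∧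
      ∀ x s, dist x (ℓ (π x)) ≤ dist x (ℓ s) := by
  have hδ : 0 < max δ 1 := lt_max_of_lt_right one_pos
  have hX' := hX.mono (le_max_left δ 1)
  choose π hπ using exists_nearest_on_line hℓ
  exact ⟨6 * max δ 1, π, ⟨hℓ, by positivity, hX'.four_point hδ,
    fun x t => hX'.dist_add_abs_le_of_nearest hδ hℓ (hπ x) t⟩, hπ⟩

theorem abs_proj_sub_le_projDist {X : Type*} [MetricSpace X] {G : Type*} [Group G] [MulAction G X]
    (hiso : ∀ (g : G) (x y : X), dist (g • x) (g • y) = dist x y) {ℓ : ℝ → X}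
    (hℓ : ∀ s t : ℝ, dist (ℓ s) (ℓ t) = |s - t|) {π : X → ℝ}
    (hπ : ∀ x s, dist x (ℓ (π x)) ≤ dist x (ℓ s)) (u : G) (x y : X) :
    |π (u⁻¹ • x) - π (u⁻¹ • y)| ≤ projDist (u • range ℓ) {x} {y} := by
  have hmem : ∀ z, u • ℓ (π (u⁻¹ • z)) ∈ nearestPts (u • range ℓ) z := by
    intro z
    have hA : u • ℓ (π (u⁻¹ • z)) ∈ u • range ℓ := smul_mem_smul_set (mem_range_self _)
    refine ⟨hA, le_antisymm ?_ (infDist_le_dist_of_mem hA)⟩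
    refine (le_infDist ⟨_, hA⟩).2 ?_
    rintro _ ⟨_, ⟨s, rfl⟩, rfl⟩
    change dist z (u • ℓ _) ≤ dist z (u • ℓ s)
    rw [← CoarseProjection.dist_inv_smul hiso, ← CoarseProjection.dist_inv_smul hiso]
    exact hπ _ s
  have hnear : ∀ z, Bornology.IsBounded (nearestPts (u • range ℓ) z) := fun z =>
    isBounded_closedBall.subset fun a ha => by
      rw [mem_closedBall, dist_comm]
      exact ha.2.le
  have hbdd : Bornology.IsBounded (projSet (u • range ℓ) ({x} ∪ {y})) := by
    rw [projSet, biUnion_union, biUnion_singleton, biUnion_singleton]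
    exact (hnear x).union (hnear y)
  have := dist_le_diam_of_mem hbdd
    (mem_biUnion (mem_union_left _ (mem_singleton x)) (hmem x))
    (mem_biUnion (mem_union_right _ (mem_singleton y)) (hmem y))
  rwa [hiso, hℓ] at this

theorem exists_maximal_separated {G : Type*} [Group G] {F : Set G} (B : Set G) (h1 : 1 ∈ B) :
    ∃ A ⊆ B, 1 ∈ A ∧ (A.Pairwise fun g k => g⁻¹ * k ∉ F ∧ k⁻¹ * g ∉ F) ∧
      ∀ b ∈ B, ∃ a ∈ A, a = b ∨ b⁻¹ * a ∈ F ∪ F⁻¹ := by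
  obtain ⟨A, h1A, hA⟩ := zorn_subset_nonempty
    {A : Set G | A ⊆ B ∧ A.Pairwise fun g k => g⁻¹ * k ∉ F ∧ k⁻¹ * g ∉ F}
    (fun C hC hchain _ => ⟨⋃₀ C, ⟨sUnion_subset fun s hs => (hC hs).1,
      (pairwise_sUnion hchain.directedOn).2 fun s hs => (hC hs).2⟩,
      fun s hs => subset_sUnion_of_mem hs⟩)
    {1} ⟨by simpa using h1, pairwise_singleton _ _⟩
  refine ⟨A, hA.prop.1, h1A rfl, hA.prop.2, fun b hb => ?_⟩
  by_contra! hcon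
  have hins : insert b A ∈
      {A : Set G | A ⊆ B ∧ A.Pairwise fun g k => g⁻¹ * k ∉ F ∧ k⁻¹ * g ∉ F} := by
    refine ⟨insert_subset hb hA.prop.1, hA.prop.2.insert fun a ha _ => ?_⟩
    have := (hcon a ha).2
    simp only [mem_union, mem_inv, mul_inv_rev, inv_inv, not_or] at this
    exact ⟨this, this.symm⟩
  exact (hcon b (hA.le_of_ge hins (subset_insert b A) (mem_insert b A))).1 rfl

theorem RoughlyBranching.of_finite {G : Type*} [Group G] {S : Finset G} {B B' T : Set G}
    (hT : T.Finite) (hB : ∀ b ∈ B, ∃ b' ∈ B', b⁻¹ * b' ∈ T)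
    (hB' : ∀ l l' : List G, l.length = l'.length → (∀ b ∈ l, b ∈ B') → (∀ b ∈ l', b ∈ B') →
      l.prod = l'.prod → l = l') :
    ∃ r : ℝ, 0 < r ∧ RoughlyBranching S r B := by
  obtain ⟨n, hn⟩ := (hT.image (wordNorm S)).bddAbove
  refine ⟨n + 1, by positivity, B', fun b hb => ?_, fun k _ g h hg hh hprod => ?_⟩
  · obtain ⟨b', hb', hbb'⟩ := hB b hb
    have : wordDist S b b' ≤ n := hn ⟨_, hbb', rfl⟩
    exact ⟨b', hb', by exact_mod_cast this.trans n.le_succ⟩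
  · refine List.ofFn_injective (hB' _ _ (by simp) ?_ ?_ hprod)
    · simpa [List.mem_ofFn] using hg
    · simpa [List.mem_ofFn] using hh

/-- **The non-fellow-traveling set `𝒩𝓕_D` is roughly branching**
(Proposition 7.4 of the paper). -/
theorem NF_roughlyBranching
    {X : Type*} [MetricSpace X] {G : Type*} [Group G] [MulAction G X]
    (δ : ℝ) (hX : GromovHyperbolic X δ)
    (hiso : ∀ (g : G) (x y : X), dist (g • x) (g • y) = dist x y)
    (hnvc : ¬ VirtuallyCyclic G)
    (f : G) (ℓ : ℝ → X) (hgeo : ∀ s t : ℝ, dist (ℓ s) (ℓ t) = |s - t|)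
    (haxis : ∀ t : ℝ, f • ℓ t = ℓ (t + 1))
    (x₀ : X) (hx₀ : x₀ ∈ Set.range ℓ) (hwpd : WPD f x₀)
    (S : Finset G) (hgen : Subgroup.closure (S : Set G) = ⊤) :
    ∀ D : ℝ, 0 < D → ∃ r : ℝ, 0 < r ∧
      RoughlyBranching S r
        {g : G | ∀ u : G, projDist (u • Set.range ℓ) {x₀} {g • x₀} < D} := by
  intro D hD
  obtain ⟨t₀, rfl⟩ := hx₀
  set ℓ' : ℝ → X := fun t => ℓ (t₀ + t) with hℓ'
  have hgeo' : ∀ s t : ℝ, dist (ℓ' s) (ℓ' t) = |s - t| := fun s t => by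
    rw [hℓ', hgeo]; congr 1; ring
  have haxis' : ∀ t : ℝ, f • ℓ' t = ℓ' (t + 1) := fun t => by
    simp only [hℓ', haxis]; congr 1; ring
  have hbase : ℓ t₀ = ℓ' 0 := by simp [hℓ']
  have hrange : range ℓ = range ℓ' := ((add_left_surjective t₀).range_comp ℓ).symm
  rw [hbase] at hwpd
  rw [hbase, hrange]
  obtain ⟨c, π, hπ, hnear⟩ := hX.exists_coarseProjection hgeo'
  have hc := hπ.pos
  set B : Set G := {g | ∀ u : G, |π (u⁻¹ • ℓ' 0) - π (u⁻¹ • g • ℓ' 0)| ≤ D}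
  have hNF : {g : G | ∀ u : G, projDist (u • range ℓ') {ℓ' 0} {g • ℓ' 0} < D} ⊆ B :=
    fun g hg u => (abs_proj_sub_le_projDist hiso hgeo' hnear u _ _).trans (hg u).le
  have h1B : (1 : G) ∈ B := fun u => by simpa using hD.le
  have hBB : ∀ g ∈ B, ∀ k ∈ B, |π ((g⁻¹ * k) • ℓ' 0)| ≤ 2 * D + c := by
    intro g hg k hk
    have h0 := abs_le.1 (hπ.abs_proj_line_sub_le 0)
    have h1 := hg g
    rw [inv_smul_smul] at h1
    have h1 := abs_le.1 h1
    have h2 := abs_le.1 (hk g)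
    rw [mul_smul, abs_le]
    constructor <;> linarith
  obtain ⟨F, K, hF, hK, hFK⟩ :=
    hπ.exists_finite_forall_proj_le hiso haxis' hwpd (E := 2 * D + c) (by positivity)
  obtain ⟨A, hAB, h1A, hAsep, hAmax⟩ := exists_maximal_separated (F := F) B h1B
  have hbeh : A.Pairwise fun g k => ∀ z, |π (g⁻¹ • z)| ≤ K + 3 * c ∨
      |π (k⁻¹ • z)| ≤ K + 3 * c := by
    intro g hg k hk hgk
    have h1 := hBB g (hAB hg) k (hAB hk)
    have h2 := hBB k (hAB hk) g (hAB hg)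
    refine hπ.behrstock hiso (hFK _ h1 ?_ (hAsep hg hk hgk).1)
      (hFK _ h2 ?_ (hAsep hg hk hgk).2)
    · simpa using h2
    · simpa using h1
  have hF' : (insert 1 (F ∪ F⁻¹)).Finite := (hF.union hF.inv).insert 1
  have hcov : ∀ b ∈ B, ∃ a ∈ A, b⁻¹ * a ∈ insert 1 (F ∪ F⁻¹) := by
    intro b hb
    obtain ⟨a, ha, rfl | h⟩ := hAmax b hb
    · exact ⟨a, ha, .inl (inv_mul_cancel a)⟩
    · exact ⟨a, ha, .inr h⟩
  rcases (A \ {1}).eq_empty_or_nonempty with hempty | ⟨a₀, ha₀⟩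
  · have hA1 : ∀ a ∈ A, a = 1 := fun a ha => by
      by_contra h
      exact (hempty ▸ (⟨ha, h⟩ : a ∈ A \ {1}) : a ∈ (∅ : Set G))
    refine RoughlyBranching.of_finite (B' := {1}) hF' (fun b hb => ?_)
      fun l l' hlen hl hl' _ => ?_
    · obtain ⟨a, ha, h⟩ := hcov b (hNF hb)
      exact ⟨a, hA1 a ha, h⟩
    · rw [List.eq_replicate_of_mem hl, List.eq_replicate_of_mem hl', hlen]
  · obtain ⟨N, hN⟩ := exists_nat_gt (2 * (K + 3 * c) + c)
    refine RoughlyBranching.of_finite (B' := (fun g => g * f ^ N) '' (A \ {1}))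
      ((hF'.image fun w => w * f ^ N).union (hF'.image fun w => w * (a₀ * f ^ N)))
      (fun b hb => ?_) fun l l' hlen hl hl' hprod =>
        hπ.prod_injective hiso haxis' (by linarith) (fun g hg z => ?_)
          (hbeh.mono sdiff_subset) hN l l' hlen hl hl' hprod
    · obtain ⟨a, ha, h⟩ := hcov b (hNF hb)
      by_cases ha1 : a = 1
      · rw [ha1, mul_one] at h
        exact ⟨_, ⟨a₀, ha₀, rfl⟩, .inr ⟨b⁻¹, h, rfl⟩⟩
      · exact ⟨_, ⟨a, ⟨ha, ha1⟩, rfl⟩, .inl ⟨b⁻¹ * a, h, by simp [mul_assoc]⟩⟩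
    · simpa using hbeh h1A hg.1 (Ne.symm hg.2) z
end
end
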